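/- arXiv:2312.01149 — 17 statements merged into one kernel-verified Lean document; each statement's English description precedes it below -/
import Mathlib

section
/- Every minimal DD₂-graph has at least 3 vertices in each of its connected components, and the path P₃ on three vertices is a minimal DD₂-graph (it is the smallest minimal DD₂-graph). -/
/-- `D` is a dominating set of `G`: every vertex outside `D` has a neighbor in `D`. -/
def Dominating {V : Type*} (G : SimpleGraph V) (D : Set V) : Prop :=
  ∀ v ∉ D, ∃ u ∈ D, G.Adj u v

/-- `D` is a 2-dominating set of `G`: every vertex outside `D` has at least two
neighbors in `D`. -/
def TwoDominating {V : Type*} (G : SimpleGraph V) (D : Set V) : Prop :=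
  ∀ v ∉ D, ∃ u ∈ D, ∃ w ∈ D, u ≠ w ∧ G.Adj u v ∧ G.Adj w v

/-- `G` is a `DD₂`-graph: there are disjoint sets `D`, `D₂` such that `D` is dominating
and `D₂` is 2-dominating. -/
def IsDD2 {V : Type*} (G : SimpleGraph V) : Prop :=
  ∃ D D2 : Set V, Disjoint D D2 ∧ Dominating G D ∧ TwoDominating G D2

/-- `G` is a minimal `DD₂`-graph: `G` is a `DD₂`-graph and no proper spanning subgraph
of `G` is a `DD₂`-graph.  (For disconnected graphs this is equivalent to every connected
component being a minimal `DD₂`-graph.) -/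
def MinimalDD2 {V : Type*} (G : SimpleGraph V) : Prop :=
  IsDD2 G ∧ ∀ H : SimpleGraph V, H < G → ¬ IsDD2 H

/-- In a `DD₂`-graph every vertex is connected to a vertex with two distinct neighbors. -/
theorem IsDD2.exists_reachable_two_neighbors {V : Type*} {G : SimpleGraph V} (h : IsDD2 G)
    (v : V) : ∃ c a b, G.Reachable v c ∧ a ≠ b ∧ G.Adj a c ∧ G.Adj b c := by
  obtain ⟨D, D2, hdisj, hD, hD2⟩ := h
  by_cases hv : v ∈ D2
  · obtain ⟨u, hu, huv⟩ := hD v (Set.disjoint_right.mp hdisj hv)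
    obtain ⟨a, -, b, -, hab, ha, hb⟩ := hD2 u (Set.disjoint_left.mp hdisj hu)
    exact ⟨u, a, b, huv.symm.reachable, hab, ha, hb⟩
  · obtain ⟨a, -, b, -, hab, ha, hb⟩ := hD2 v hv
    exact ⟨v, a, b, .refl v, hab, ha, hb⟩

/-- Every component of a finite `DD₂`-graph has at least three vertices. -/
theorem IsDD2.three_le_ncard_reachable {V : Type*} [Finite V] {G : SimpleGraph V}
    (h : IsDD2 G) (v : V) : 3 ≤ {u | G.Reachable v u}.ncard := by
  obtain ⟨c, a, b, hc, hab, ha, hb⟩ := h.exists_reachable_two_neighbors v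
  have hsub : ({c, a, b} : Set V) ⊆ {u | G.Reachable v u} := by
    rintro x (rfl | rfl | rfl)
    exacts [hc, hc.trans ha.symm.reachable, hc.trans hb.symm.reachable]
  have hcard : ({c, a, b} : Set V).ncard = 3 :=
    Set.ncard_eq_three.mpr ⟨c, a, b, ha.ne', hb.ne', hab, rfl⟩
  exact hcard ▸ Set.ncard_le_ncard hsub (Set.toFinite _)

/-- The path on three vertices is a `DD₂`-graph. -/
theorem isDD2_pathGraph_three : IsDD2 (SimpleGraph.pathGraph 3) := by
  refine ⟨{1}, {0, 2}, by simp, fun v hv => ⟨1, rfl, ?_⟩,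
    fun v hv => ⟨0, by simp, 2, by simp, by decide, ?_⟩⟩
  all_goals
    fin_cases v <;> simp_all [SimpleGraph.pathGraph_adj]

/-- A spanning `DD₂`-subgraph of the path on three vertices is the whole path. -/
theorem IsDD2.pathGraph_three_le {H : SimpleGraph (Fin 3)} (h : IsDD2 H)
    (hle : H ≤ SimpleGraph.pathGraph 3) : SimpleGraph.pathGraph 3 ≤ H := by
  obtain ⟨c, a, b, -, hab, ha, hb⟩ := h.exists_reachable_two_neighbors 0
  have ha' := SimpleGraph.pathGraph_adj.mp (hle ha)
  have hb' := SimpleGraph.pathGraph_adj.mp (hle hb)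
  intro x y hxy
  rw [SimpleGraph.pathGraph_adj] at hxy
  have key : (x = a ∧ y = c) ∨ (x = c ∧ y = a) ∨ (x = b ∧ y = c) ∨ (x = c ∧ y = b) := by
    omega
  rcases key with ⟨rfl, rfl⟩ | ⟨rfl, rfl⟩ | ⟨rfl, rfl⟩ | ⟨rfl, rfl⟩
  exacts [ha, ha.symm, hb, hb.symm]

/-- Every (finite) minimal `DD₂`-graph has at least 3 vertices in each of
its connected components, and the path `P₃` on three vertices is a minimal `DD₂`-graph. -/
theorem minimalDD2_components_card_ge_three_and_pathGraph_three_minimalDD2 :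
    (∀ (V : Type) [Fintype V] (G : SimpleGraph V),
      MinimalDD2 G → ∀ v : V, 3 ≤ {u | G.Reachable v u}.ncard) ∧
    MinimalDD2 (SimpleGraph.pathGraph 3) :=
  ⟨fun _ _ _ hG v => hG.1.three_le_ncard_reachable v,
    isDD2_pathGraph_three, fun _ hlt hH => hlt.not_ge (hH.pathGraph_three_le hlt.le)⟩
end

section
/- If G is a minimal DD₂-graph with n vertices and m edges, then m ≥ 2n/3. In particular, every minimal spanning DD₂-subgraph of an n-vertex graph has at least 2n/3 edges. -/
/-- If every vertex of `A` has a neighbor outside `A`, choosing an edge to such a neighbor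
is injective, so the graph has at least `|A|` edges. -/
theorem ncard_le_ncard_edgeSet_of_forall_exists_adj {V : Type*} [Finite V] {G : SimpleGraph V}
    {A : Set V} (h : ∀ v ∈ A, ∃ u ∉ A, G.Adj u v) : A.ncard ≤ G.edgeSet.ncard := by
  choose! f hfA hf using h
  refine Set.ncard_le_ncard_of_injOn (fun v => s(f v, v)) (fun v hv => hf v hv) ?_ (Set.toFinite _)
  intro v hv w hw hvw
  have h1 := hfA v hv
  have h2 := hfA w hw
  simp only [Sym2.eq_iff] at hvw
  grind

/-- The edges between a 2-dominating set and its complement number at least twice the size of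
the complement. -/
theorem TwoDominating.two_mul_ncard_compl_le {V : Type*} [Finite V] {G : SimpleGraph V}
    {A : Set V} (h : TwoDominating G A) : 2 * Aᶜ.ncard ≤ G.edgeSet.ncard := by
  unfold TwoDominating at h
  choose! f hfA g hgA hfg hf hg using h
  have hcard : (Aᶜ ×ˢ (Set.univ : Set Bool)).ncard = 2 * Aᶜ.ncard := by
    rw [Set.ncard_prod, Set.ncard_univ, Nat.card_eq_fintype_card, Fintype.card_bool, mul_comm]
  rw [← hcard]
  refine Set.ncard_le_ncard_of_injOn (fun p => s(cond p.2 (f p.1) (g p.1), p.1)) ?_ ?_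
    (Set.toFinite _)
  · rintro ⟨v, b⟩ ⟨hv, -⟩
    cases b
    · exact hg v hv
    · exact hf v hv
  · rintro ⟨v, b⟩ ⟨hv, -⟩ ⟨w, c⟩ ⟨hw, -⟩ hvw
    simp only [Set.mem_compl_iff] at hv hw
    have h1 := hfA v hv
    have h2 := hfA w hw
    have h3 := hgA v hv
    have h4 := hgA w hw
    have h5 := hfg v hv
    simp only [Sym2.eq_iff] at hvw
    cases b <;> cases c <;> simp only [cond_true, cond_false] at hvw <;> grind

/-- A minimal `DD₂`-graph with `n` vertices and `m` edges satisfies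
`m ≥ 2n/3`; in particular every minimal spanning `DD₂`-subgraph of an `n`-vertex graph
has at least `2n/3` edges. -/
theorem minimalDD2_edge_lower_bound {V : Type} [Fintype V] (G : SimpleGraph V)
    (hG : MinimalDD2 G) :
    2 * Fintype.card V ≤ 3 * G.edgeSet.ncard := by
  obtain ⟨⟨D, A, hdisj, hD, hA⟩, -⟩ := hG
  have h1 : A.ncard ≤ G.edgeSet.ncard := by
    refine ncard_le_ncard_edgeSet_of_forall_exists_adj fun v hv => ?_
    obtain ⟨u, hu, huv⟩ := hD v (Set.disjoint_right.mp hdisj hv)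
    exact ⟨u, Set.disjoint_left.mp hdisj hu, huv⟩
  have h2 := hA.two_mul_ncard_compl_le
  have h3 := Set.ncard_add_ncard_compl A
  rw [Nat.card_eq_fintype_card] at h3
  lia
end

section
/- A connected graph G is a DD₂-graph if and only if G has a spanning bipartite subgraph T = (A ∪ B, E_T) (i.e., V(T)=V(G) is partitioned into two disjoint sets A and B, E_T ⊆ E(G), and every edge of T joins a vertex of A to a vertex of B) such that d_T(a) ≥ 2 for every a ∈ A and d_T(b) ≥ 1 for every b ∈ B. -/
/-- A connected graph `G` is a `DD₂`-graph iff it has a spanning bipartite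
subgraph `T` with parts `A, B` in which every vertex of `A` has degree at least `2`
and every vertex of `B` has degree at least `1`. -/
theorem isDD2_iff_exists_spanning_bipartite_subgraph {V : Type} [Fintype V]
    (G : SimpleGraph V) (hconn : G.Connected) :
    IsDD2 G ↔ ∃ (T : SimpleGraph V) (A B : Set V),
      T ≤ G ∧ Disjoint A B ∧ A ∪ B = Set.univ ∧
      (∀ u v : V, T.Adj u v → (u ∈ A ∧ v ∈ B) ∨ (u ∈ B ∧ v ∈ A)) ∧
      (∀ a ∈ A, 2 ≤ (T.neighborSet a).ncard) ∧
      (∀ b ∈ B, 1 ≤ (T.neighborSet b).ncard) := by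
  constructor
  · rintro ⟨D, D₂, hdisj, hD, hD₂⟩
    let T : SimpleGraph V :=
      { Adj := fun u v => G.Adj u v ∧ ((u ∈ D₂ᶜ ∧ v ∈ D₂) ∨ (u ∈ D₂ ∧ v ∈ D₂ᶜ))
        symm := ⟨fun u v h => ⟨h.1.symm, h.2.symm.imp And.symm And.symm⟩⟩
        loopless := ⟨fun u h => G.loopless.irrefl u h.1⟩ }
    refine ⟨T, D₂ᶜ, D₂, fun u v h => h.1, disjoint_compl_left, Set.compl_union_self D₂,
      fun u v h => h.2, fun a ha => ?_, fun b hb => ?_⟩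
    · obtain ⟨u, hu, w, hw, huw, hua, hwa⟩ := hD₂ a ha
      exact (Set.one_lt_ncard (Set.toFinite _)).2
        ⟨u, ⟨hua.symm, .inl ⟨ha, hu⟩⟩, w, ⟨hwa.symm, .inl ⟨ha, hw⟩⟩, huw⟩
    · obtain ⟨u, hu, hub⟩ := hD b (hdisj.notMem_of_mem_right hb)
      exact (Set.ncard_pos (Set.toFinite _)).2
        ⟨u, hub.symm, .inr ⟨hb, hdisj.notMem_of_mem_left hu⟩⟩
  · rintro ⟨T, A, B, hTG, hdisj, hcover, hbip, hA, hB⟩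
    refine ⟨A, B, hdisj, fun v hv => ?_, fun v hv => ?_⟩
    · have hvB : v ∈ B := (hcover.ge (Set.mem_univ v)).resolve_left hv
      obtain ⟨u, hu⟩ := (Set.ncard_pos (Set.toFinite _)).1 (hB v hvB)
      have huA : u ∈ A := ((hbip v u hu).resolve_left fun h => hv h.1).2
      exact ⟨u, huA, (hTG hu).symm⟩
    · have hvA : v ∈ A := (hcover.ge (Set.mem_univ v)).resolve_right hv
      obtain ⟨u, hu, w, hw, huw⟩ := (Set.one_lt_ncard (Set.toFinite _)).1 (hA v hvA)
      have mem_B : ∀ x, T.Adj v x → x ∈ B := fun x hx =>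
        ((hbip v x hx).resolve_right fun h => hv h.1).2
      exact ⟨u, mem_B u hu, w, mem_B w hw, huw, (hTG hu).symm, (hTG hw).symm⟩
end

section
/- Every finite simple graph G with minimum degree δ(G) ≥ 2 is a DD₂-graph. -/
/-- A maximal independent set is dominating. -/
theorem dominating_of_maximal_isIndepSet {V : Type*} {G : SimpleGraph V} {D : Set V}
    (hD : Maximal G.IsIndepSet D) : Dominating G D := by
  intro v hv
  by_contra! hno
  have hins : G.IsIndepSet (insert v D) := by
    refine hD.prop.insert fun u hu _ => ⟨fun hvu => hno u hu hvu.symm, hno u hu⟩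
  exact hv (hD.le_of_ge hins (Set.subset_insert v D) (Set.mem_insert v D))

/-- If every vertex has at least two neighbors, the complement of an independent set is
2-dominating. -/
theorem twoDominating_compl_of_isIndepSet {V : Type*} {G : SimpleGraph V} {D : Set V}
    (hD : G.IsIndepSet D) (h : ∀ v : V, 2 ≤ (G.neighborSet v).ncard) :
    TwoDominating G Dᶜ := by
  intro v hv
  have hvD : v ∈ D := Set.notMem_compl_iff.mp hv
  have hout : ∀ u, G.Adj v u → u ∈ Dᶜ := fun u hvu hu => hD hvD hu hvu.ne hvu
  have hfin : (G.neighborSet v).Finite :=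
    Set.finite_of_ncard_pos (by have := h v; omega)
  obtain ⟨u, hu, w, hw, huw⟩ := (Set.one_lt_ncard hfin).mp (h v)
  exact ⟨u, hout u hu, w, hout w hw, huw, hu.symm, hw.symm⟩

/-- Every finite simple graph with minimum degree at least 2 is a
`DD₂`-graph. -/
theorem isDD2_of_two_le_minDegree {V : Type} [Fintype V] (G : SimpleGraph V)
    (h : ∀ v : V, 2 ≤ (G.neighborSet v).ncard) : IsDD2 G := by
  obtain ⟨D, hD⟩ := (Set.toFinite {s : Set V | G.IsIndepSet s}).exists_maximal
    ⟨∅, Set.pairwise_empty _⟩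
  exact ⟨D, Dᶜ, disjoint_compl_right, dominating_of_maximal_isIndepSet hD,
    twoDominating_compl_of_isIndepSet hD.prop h⟩
end

section
/- A connected graph G is a minimal DD₂-graph if and only if one of the following holds: (i) G is isomorphic to a star K_{1,n} with n ≥ 2; (ii) G is isomorphic to the cycle C₄; or (iii) there is a partition of V(G) into two independent sets A and B such that every vertex a ∈ A has degree exactly 2 in G and every vertex b ∈ B is a leaf of G or is at distance two in G from some leaf of G. (Condition (iii) characterizes the subdivision graphs of connected corona multigraphs.) -/
open SimpleGraph

/-- `S` is a 2-dominating set whose complement is dominating. -/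
def SplitsDD2 {V : Type*} (G : SimpleGraph V) (S : Set V) : Prop :=
  (∀ v ∈ S, ∃ u ∉ S, G.Adj v u) ∧
    ∀ v ∉ S, ∃ u ∈ S, ∃ w ∈ S, u ≠ w ∧ G.Adj v u ∧ G.Adj v w

section

variable {V W : Type*} {G H : SimpleGraph V} {S : Set V}

theorem SplitsDD2.isDD2 (h : SplitsDD2 G S) : IsDD2 G := by
  refine ⟨Sᶜ, S, disjoint_compl_left, fun v hv => ?_, fun v hv => ?_⟩
  · obtain ⟨u, hu, huv⟩ := h.1 v (by simpa using hv)
    exact ⟨u, hu, huv.symm⟩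
  · obtain ⟨u, hu, w, hw, hne, h1, h2⟩ := h.2 v hv
    exact ⟨u, hu, w, hw, hne, h1.symm, h2.symm⟩

theorem IsDD2.exists_splitsDD2 (h : IsDD2 G) : ∃ S, SplitsDD2 G S := by
  obtain ⟨D, D2, hd, hD, hD2⟩ := h
  refine ⟨D2, fun v hv => ?_, fun v hv => ?_⟩
  · obtain ⟨u, hu, huv⟩ := hD v fun hvD => Set.disjoint_left.1 hd hvD hv
    exact ⟨u, Set.disjoint_left.1 hd hu, huv.symm⟩
  · obtain ⟨u, hu, w, hw, hne, h1, h2⟩ := hD2 v hv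
    exact ⟨u, hu, w, hw, hne, h1.symm, h2.symm⟩

theorem SplitsDD2.exists_adj (h : SplitsDD2 G S) (v : V) : ∃ u, G.Adj v u := by
  by_cases hv : v ∈ S
  · obtain ⟨u, -, hu⟩ := h.1 v hv
    exact ⟨u, hu⟩
  · obtain ⟨u, -, -, -, -, hu, -⟩ := h.2 v hv
    exact ⟨u, hu⟩

/-- A vertex with at most one neighbor lies in the 2-dominating part, and its neighbor lies in
the dominating part. -/
theorem SplitsDD2.of_unique_neighbor (h : SplitsDD2 G S) {v u : V}
    (hv : ∀ w, G.Adj v w → w = u) : v ∈ S ∧ u ∉ S ∧ G.Adj v u := by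
  have hvS : v ∈ S := by
    by_contra hvS
    obtain ⟨x, -, y, -, hne, hx, hy⟩ := h.2 v hvS
    exact hne ((hv x hx).trans (hv y hy).symm)
  obtain ⟨w, hw, hvw⟩ := h.1 v hvS
  obtain rfl := hv w hvw
  exact ⟨hvS, hw, hvw⟩

theorem IsDD2.of_iso {G' : SimpleGraph W} (e : G ≃g G') (h : IsDD2 G') : IsDD2 G := by
  obtain ⟨S, h1, h2⟩ := h.exists_splitsDD2
  refine SplitsDD2.isDD2 (S := e ⁻¹' S) ⟨fun v hv => ?_, fun v hv => ?_⟩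
  · obtain ⟨u, hu, huv⟩ := h1 (e v) hv
    exact ⟨e.symm u, by simpa using hu, by simpa [← e.map_adj_iff] using huv⟩
  · obtain ⟨u, hu, w, hw, hne, hvu, hvw⟩ := h2 (e v) hv
    exact ⟨e.symm u, by simpa using hu, e.symm w, by simpa using hw, by simpa using hne,
      by simpa [← e.map_adj_iff] using hvu, by simpa [← e.map_adj_iff] using hvw⟩

theorem MinimalDD2.of_iso {G' : SimpleGraph W} (e : G ≃g G') (h : MinimalDD2 G') :
    MinimalDD2 G := by
  refine ⟨h.1.of_iso e, fun H hH hH2 => h.2 (H.comap e.symm) ?_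
    (hH2.of_iso (Iso.comap e.symm.toEquiv H))⟩
  refine lt_of_le_not_ge (fun x y hxy => ?_) fun hle => hH.not_ge fun x y hxy => ?_
  · exact e.symm.map_adj_iff.1 (hH.le hxy)
  · simpa using hle (e.map_adj_iff.2 hxy)

/-- A graph is a minimal `DD₂`-graph if every `DD₂` spanning subgraph has all its edges. -/
theorem minimalDD2_of_forall_adj (hG : IsDD2 G)
    (h : ∀ H S, H ≤ G → SplitsDD2 H S → ∀ x y, G.Adj x y → H.Adj x y) : MinimalDD2 G := by
  refine ⟨hG, fun H hH hH2 => ?_⟩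
  obtain ⟨S, hS⟩ := hH2.exists_splitsDD2
  exact hH.not_ge fun x y => h H S hH.le hS x y

theorem MinimalDD2.not_splitsDD2_deleteEdges (hG : MinimalDD2 G) {x y : V} (hxy : G.Adj x y) :
    ¬ SplitsDD2 (G.deleteEdges {s(x, y)}) S := by
  refine fun h => hG.2 _ (lt_of_le_not_ge (deleteEdges_le _) fun hle => ?_) h.isDD2
  simpa [deleteEdges_adj] using hle hxy

/-- In a minimal `DD₂`-graph every edge joins the two parts. -/
theorem MinimalDD2.mem_iff_not_mem (hG : MinimalDD2 G) (hS : SplitsDD2 G S) {x y : V}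
    (hxy : G.Adj x y) : x ∈ S ↔ y ∉ S := by
  by_contra hc
  refine hG.not_splitsDD2_deleteEdges (S := S) hxy ⟨fun v hv => ?_, fun v hv => ?_⟩
  · obtain ⟨u, hu, huv⟩ := hS.1 v hv
    refine ⟨u, hu, deleteEdges_adj.2 ⟨huv, ?_⟩⟩
    rw [Set.mem_singleton_iff, Sym2.eq_iff]
    rintro (⟨rfl, rfl⟩ | ⟨rfl, rfl⟩) <;> tauto
  · obtain ⟨u, hu, w, hw, hne, hvu, hvw⟩ := hS.2 v hv
    refine ⟨u, hu, w, hw, hne, deleteEdges_adj.2 ⟨hvu, ?_⟩, deleteEdges_adj.2 ⟨hvw, ?_⟩⟩ <;>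
    · rw [Set.mem_singleton_iff, Sym2.eq_iff]
      rintro (⟨rfl, rfl⟩ | ⟨rfl, rfl⟩) <;> tauto

/-- In a minimal `DD₂`-graph, an edge whose end in the dominating part has degree at least three
ends in a leaf. -/
theorem MinimalDD2.unique_neighbor_of_three (hG : MinimalDD2 G) (hS : SplitsDD2 G S)
    {x y v w u : V} (hx : x ∉ S) (hxy : G.Adj x y) (hxv : G.Adj x v) (hxw : G.Adj x w)
    (hvw : v ≠ w) (hvy : v ≠ y) (hwy : w ≠ y) (hyu : G.Adj y u) : u = x := by
  by_contra hux
  have hy := hG.mem_iff_not_mem hS hxy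
  have hv := hG.mem_iff_not_mem hS hxv
  have hw := hG.mem_iff_not_mem hS hxw
  have hu := hG.mem_iff_not_mem hS hyu
  refine hG.not_splitsDD2_deleteEdges (S := S) hxy ⟨fun b hb => ?_, fun a ha => ?_⟩
  · by_cases hby : b = y
    · subst hby
      refine ⟨u, by tauto, deleteEdges_adj.2 ⟨hyu, ?_⟩⟩
      rw [Set.mem_singleton_iff, Sym2.eq_iff]
      grind
    · obtain ⟨c, hc, hbc⟩ := hS.1 b hb
      refine ⟨c, hc, deleteEdges_adj.2 ⟨hbc, ?_⟩⟩
      rw [Set.mem_singleton_iff, Sym2.eq_iff]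
      grind
  · by_cases hax : a = x
    · subst hax
      refine ⟨v, by tauto, w, by tauto, hvw, deleteEdges_adj.2 ⟨hxv, ?_⟩,
        deleteEdges_adj.2 ⟨hxw, ?_⟩⟩ <;>
      · rw [Set.mem_singleton_iff, Sym2.eq_iff]
        grind
    · obtain ⟨c, hc, d, hd, hne, hac, had⟩ := hS.2 a ha
      refine ⟨c, hc, d, hd, hne, deleteEdges_adj.2 ⟨hac, ?_⟩, deleteEdges_adj.2 ⟨had, ?_⟩⟩ <;>
      · rw [Set.mem_singleton_iff, Sym2.eq_iff]
        grind

theorem SimpleGraph.Connected.forall_of_adj_closed (hG : G.Connected) {P : V → Prop} {a : V}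
    (ha : P a) (h : ∀ x y, P x → G.Adj x y → P y) (v : V) : P v := by
  have hr := (reachable_iff_reflTransGen a v).1 (hG.preconnected a v)
  induction hr with
  | refl => exact ha
  | tail _ hxy ih => exact h _ _ ih hxy

theorem minimalDD2_completeBipartiteGraph_one {n : ℕ} (hn : 2 ≤ n) :
    MinimalDD2 (completeBipartiteGraph (Fin 1) (Fin n)) := by
  refine minimalDD2_of_forall_adj
    (SplitsDD2.isDD2 (S := Set.range Sum.inr) ⟨?_, ?_⟩) fun H S hle hS => ?_
  · rintro _ ⟨i, rfl⟩
    exact ⟨Sum.inl 0, by simp, by simp⟩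
  · rintro (i | i) hi
    · exact ⟨Sum.inr ⟨0, by omega⟩, by simp, Sum.inr ⟨1, by omega⟩, by simp, by simp, by simp,
        by simp⟩
    · simp at hi
  · have key : ∀ (i : Fin 1) (j : Fin n), H.Adj (Sum.inr j) (Sum.inl i) := by
      intro i j
      obtain ⟨u, hu⟩ := hS.exists_adj (Sum.inr j)
      rcases u with k | k
      · rwa [Subsingleton.elim i k]
      · simpa using hle hu
    rintro (i | i) (j | j) hij
    · simp at hij
    · exact (key i j).symm
    · exact key j i
    · simp at hij

/-- A spanning `DD₂`-subgraph of a 4-cycle `a b c d` has the edge `a b`. -/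
theorem SplitsDD2.adj_of_cycle (hS : SplitsDD2 H S) {a b c d : V}
    (ha : ∀ w, H.Adj a w → w = b ∨ w = d) (hb : ∀ w, H.Adj b w → w = c ∨ w = a)
    (hc : ∀ w, H.Adj c w → w = d ∨ w = b) : H.Adj a b := by
  by_contra hab
  obtain ⟨-, hd, -⟩ := hS.of_unique_neighbor (v := a) (u := d) fun w hw =>
    (ha w hw).resolve_left (by rintro rfl; exact hab hw)
  obtain ⟨-, hc', -⟩ := hS.of_unique_neighbor (v := b) (u := c) fun w hw =>
    (hb w hw).resolve_right (by rintro rfl; exact hab hw.symm)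
  obtain ⟨x, hx, y, hy, hne, hcx, hcy⟩ := hS.2 c hc'
  rcases hc x hcx with rfl | rfl
  · exact hd hx
  · rcases hc y hcy with rfl | rfl
    · exact hd hy
    · exact hne rfl

theorem minimalDD2_cycleGraph_four : MinimalDD2 (cycleGraph 4) := by
  refine minimalDD2_of_forall_adj
    (SplitsDD2.isDD2 (S := {v | v = 0 ∨ v = 2}) ⟨?_, ?_⟩) fun H S hle hS => ?_
  · simp only [Set.mem_ofPred_eq]; decide
  · simp only [Set.mem_ofPred_eq]; decide
  · have hN : ∀ v w : Fin 4, H.Adj v w → w = v + 1 ∨ w = v + 3 := fun v w h =>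
      (by decide : ∀ v w : Fin 4, (cycleGraph 4).Adj v w → w = v + 1 ∨ w = v + 3) v w (hle h)
    have key : ∀ v : Fin 4, H.Adj v (v + 1) := by
      intro v
      refine hS.adj_of_cycle (c := v + 2) (d := v + 3) (hN v) (fun w hw => ?_) (fun w hw => ?_)
      · exact (by decide : ∀ v w : Fin 4, w = v + 1 + 1 ∨ w = v + 1 + 3 → w = v + 2 ∨ w = v) v w
          (hN _ _ hw)
      · exact (by decide : ∀ v w : Fin 4, w = v + 2 + 1 ∨ w = v + 2 + 3 → w = v + 3 ∨ w = v + 1)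
          v w (hN _ _ hw)
    intro x y hxy
    rcases (by decide : ∀ v w : Fin 4, (cycleGraph 4).Adj v w → w = v + 1 ∨ v = w + 1) x y hxy
      with rfl | rfl
    · exact key x
    · exact (key y).symm

theorem SimpleGraph.dist_eq_two_iff {u v : V} :
    G.dist u v = 2 ↔ u ≠ v ∧ ¬ G.Adj u v ∧ ∃ w, G.Adj u w ∧ G.Adj v w := by
  have : G.dist u v = 2 ↔ G.edist u v = 2 := by
    rw [SimpleGraph.dist, ENat.toNat_eq_iff (by norm_num)]; rfl
  rw [this, edist_eq_two_iff]
  rfl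

theorem minimalDD2_of_subdivision_corona {A B : Set V}
    (hAB : Disjoint A B) (hU : A ∪ B = Set.univ)
    (hA : ∀ u ∈ A, ∀ v ∈ A, ¬ G.Adj u v) (hB : ∀ u ∈ B, ∀ v ∈ B, ¬ G.Adj u v)
    (hdeg : ∀ a ∈ A, (G.neighborSet a).ncard = 2)
    (hcor : ∀ b ∈ B, (G.neighborSet b).ncard = 1 ∨
      ∃ l : V, (G.neighborSet l).ncard = 1 ∧ G.dist b l = 2) : MinimalDD2 G := by
  have hmem : ∀ v, v ∉ B ↔ v ∈ A := fun v => by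
    have h1 : v ∈ A ∪ B := hU ▸ Set.mem_univ v
    have h2 : v ∈ A → v ∉ B := fun h => Set.disjoint_left.1 hAB h
    rcases h1 with h1 | h1 <;> tauto
  have htwo : ∀ a ∈ A, ∃ x y, x ≠ y ∧ ∀ w, G.Adj a w ↔ w = x ∨ w = y := by
    intro a ha
    obtain ⟨x, y, hne, hxy⟩ := Set.ncard_eq_two.1 (hdeg a ha)
    exact ⟨x, y, hne, fun w => by rw [← mem_neighborSet, hxy]; simp⟩
  have hone : ∀ l, (G.neighborSet l).ncard = 1 → ∃ x, ∀ w, G.Adj l w ↔ w = x := by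
    intro l hl
    obtain ⟨x, hx⟩ := Set.ncard_eq_one.1 hl
    exact ⟨x, fun w => by rw [← mem_neighborSet, hx]; simp⟩
  refine minimalDD2_of_forall_adj (SplitsDD2.isDD2 (S := B) ⟨fun b hb => ?_, fun a ha => ?_⟩)
    fun H S hle hS => ?_
  · obtain ⟨u, hu⟩ : ∃ u, G.Adj b u := by
      rcases hcor b hb with h | ⟨l, -, hl⟩
      · obtain ⟨x, hx⟩ := hone b h
        exact ⟨x, (hx x).2 rfl⟩
      · obtain ⟨-, -, w, hw, -⟩ := SimpleGraph.dist_eq_two_iff.1 hl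
        exact ⟨w, hw⟩
    exact ⟨u, fun huB => hB b hb u huB hu, hu⟩
  · rw [hmem] at ha
    obtain ⟨x, y, hne, hxy⟩ := htwo a ha
    have hx := (hxy x).2 (Or.inl rfl)
    have hy := (hxy y).2 (Or.inr rfl)
    exact ⟨x, by_contra fun h => hA a ha x ((hmem x).1 h) hx, y,
      by_contra fun h => hA a ha y ((hmem y).1 h) hy, hne, hx, hy⟩
  · have hcenter : ∀ a ∈ A, a ∉ S → ∀ w, G.Adj a w → w ∈ S ∧ H.Adj a w := by
      intro a ha haS w hw
      obtain ⟨x, y, -, hxy⟩ := htwo a ha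
      obtain ⟨u, hu, v, hv, huv, hau, hav⟩ := hS.2 a haS
      have h1 := (hxy u).1 (hle hau)
      have h2 := (hxy v).1 (hle hav)
      have h3 := (hxy w).1 hw
      have : w = u ∨ w = v := by grind
      rcases this with rfl | rfl
      · exact ⟨hu, hau⟩
      · exact ⟨hv, hav⟩
    have hleaf : ∀ l, (G.neighborSet l).ncard = 1 → l ∈ S ∧ ∀ w, G.Adj l w → w ∉ S := by
      intro l hl
      obtain ⟨x, hx⟩ := hone l hl
      obtain ⟨h1, h2, -⟩ := hS.of_unique_neighbor (v := l) (u := x) fun w hw => (hx w).1 (hle hw)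
      exact ⟨h1, fun w hw => (hx w).1 hw ▸ h2⟩
    have hBS : B ⊆ S := by
      intro b hb
      rcases hcor b hb with h | ⟨l, hl, hd⟩
      · exact (hleaf b h).1
      · obtain ⟨-, -, w, hbw, hlw⟩ := SimpleGraph.dist_eq_two_iff.1 hd
        exact (hcenter w ((hmem w).1 fun h => hB b hb w h hbw) ((hleaf l hl).2 w hlw) b
          hbw.symm).1
    have hAS : ∀ a ∈ A, a ∉ S := by
      intro a ha haS
      obtain ⟨u, hu, hau⟩ := hS.1 a haS
      exact hA a ha u ((hmem u).1 fun h => hu (hBS h)) (hle hau)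
    intro x y hxy
    by_cases hx : x ∈ A
    · exact (hcenter x hx (hAS x hx) y hxy).2
    · by_cases hy : y ∈ A
      · exact (hcenter y hy (hAS y hy) x hxy.symm).2.symm
      · rw [← hmem, not_not] at hx hy
        exact absurd hxy (hB x hx y hy)

theorem exists_iso_completeBipartiteGraph_one [Finite V] {a v w : V}
    (hadj : ∀ x, x ≠ a → ∀ y, G.Adj x y ↔ y = a) (hva : v ≠ a) (hwa : w ≠ a) (hvw : v ≠ w) :
    ∃ n : ℕ, 2 ≤ n ∧ Nonempty (G ≃g completeBipartiteGraph (Fin 1) (Fin n)) := by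
  classical
  have := Fintype.ofFinite V
  let e : V ≃ Fin 1 ⊕ Fin (Fintype.card {x // ¬ x = a}) :=
    (Equiv.sumCompl (· = a)).symm.trans
      (Equiv.sumCongr (Equiv.ofUnique _ _) (Fintype.equivFin _))
  refine ⟨_, ?_, ⟨⟨e, ?_⟩⟩⟩
  · exact Fintype.one_lt_card_iff.2 ⟨⟨v, hva⟩, ⟨w, hwa⟩, by simpa using hvw⟩
  · intro x y
    by_cases hx : x = a <;> by_cases hy : y = a
    · subst hx; subst hy; simp
    · subst hx
      rw [G.adj_comm, hadj y hy]
      simp [e, hy]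
    · subst hy
      rw [hadj x hx]
      simp [e, hx]
    · rw [hadj x hx]
      simp [e, hx, hy]

theorem nonempty_iso_cycleGraph_four {a b c d : V} (huniv : ∀ v, v = a ∨ v = b ∨ v = c ∨ v = d)
    (hac : a ≠ c) (hbd : b ≠ d) (hab : G.Adj a b) (hbc : G.Adj b c) (hcd : G.Adj c d)
    (hda : G.Adj d a) (hnac : ¬ G.Adj a c) (hnbd : ¬ G.Adj b d) :
    Nonempty (G ≃g cycleGraph 4) := by
  have hbij : Function.Bijective ![a, b, c, d] := by
    constructor
    · have := hab.ne
      have := hbc.ne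
      have := hcd.ne
      have := hda.ne
      intro i j hij
      fin_cases i <;> fin_cases j <;> simp_all
    · intro v
      rcases huniv v with rfl | rfl | rfl | rfl
      exacts [⟨0, rfl⟩, ⟨1, rfl⟩, ⟨2, rfl⟩, ⟨3, rfl⟩]
  refine ⟨(RelIso.symm ⟨Equiv.ofBijective _ hbij, ?_⟩)⟩
  intro i j
  have := hab.symm
  have := hbc.symm
  have := hcd.symm
  have := hda.symm
  have : ¬ G.Adj c a := fun h => hnac h.symm
  have : ¬ G.Adj d b := fun h => hnbd h.symm
  fin_cases i <;> fin_cases j <;> simp [*, cycleGraph_adj] <;> decide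

/-- In a connected minimal `DD₂`-graph whose dominating part has all degrees equal to two, a
vertex of the 2-dominating part that is not a leaf and has no leaf at distance two lies on a
4-cycle forming the whole graph. -/
theorem MinimalDD2.nonempty_iso_cycleGraph_four (hG : MinimalDD2 G) (hconn : G.Connected)
    (hS : SplitsDD2 G S)
    (hdeg : ∀ a ∉ S, ∃ x y, x ≠ y ∧ ∀ w, G.Adj a w ↔ w = x ∨ w = y) {b p q : V} (hb : b ∈ S)
    (hpq : p ≠ q) (hp : G.Adj b p) (hq : G.Adj b q)
    (hfar : ∀ a l, G.Adj b a → G.Adj a l → l ≠ b → ∃ u w, u ≠ w ∧ G.Adj l u ∧ G.Adj l w) :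
    Nonempty (G ≃g cycleGraph 4) := by
  have hbip := fun {x y : V} (h : G.Adj x y) => hG.mem_iff_not_mem hS h
  let T : Set V := {v | G.Adj b v ∨ v ∈ S ∧ v ≠ b ∧ ∃ u, G.Adj v u ∧ ¬ G.Adj b u}
  have hmem : ∀ v, v ∈ T ↔ G.Adj b v ∨ v ∈ S ∧ v ≠ b ∧ ∃ u, G.Adj v u ∧ ¬ G.Adj b u :=
    fun v => Iff.rfl
  have hbT : b ∉ T := by simp [hmem]
  have hT : SplitsDD2 G T := by
    refine ⟨fun v hv => ?_, fun v hv => ?_⟩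
    · rcases hv with hv | ⟨hvS, hvb, u, hvu, hbu⟩
      · exact ⟨b, hbT, hv.symm⟩
      · refine ⟨u, fun hu => ?_, hvu⟩
        have := hbip hvu
        rw [hmem] at hu
        tauto
    · by_cases hvS : v ∈ S
      · by_cases hvb : v = b
        · subst hvb
          exact ⟨p, Or.inl hp, q, Or.inl hq, hpq, hp, hq⟩
        · have hN : ∀ u, G.Adj v u → G.Adj b u := by
            intro u hu
            by_contra h
            exact hv (Or.inr ⟨hvS, hvb, u, hu, h⟩)
          obtain ⟨r, hr⟩ := hS.exists_adj v
          obtain ⟨u, w, hne, hu, hw⟩ := hfar r v (hN r hr) hr.symm hvb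
          exact ⟨u, Or.inl (hN u hu), w, Or.inl (hN w hw), hne, hu, hw⟩
      · have hbv : ¬ G.Adj b v := fun h => hv (Or.inl h)
        obtain ⟨x, hx, y, hy, hne, hvx, hvy⟩ := hS.2 v hvS
        exact ⟨x, Or.inr ⟨hx, by rintro rfl; exact hbv hvx.symm, v, hvx.symm, hbv⟩,
          y, Or.inr ⟨hy, by rintro rfl; exact hbv hvy.symm, v, hvy.symm, hbv⟩, hne, hvx, hvy⟩
  have hother : ∀ a, G.Adj b a → ∃ c, c ≠ b ∧ G.Adj a c ∧ (∀ w, G.Adj a w → w = b ∨ w = c) ∧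
      ∀ u, G.Adj c u → G.Adj b u := by
    intro a hba
    obtain ⟨c, hcb, hac, hc⟩ :
        ∃ c, c ≠ b ∧ G.Adj a c ∧ (∀ w, G.Adj a w → w = b ∨ w = c) := by
      obtain ⟨x, y, hne, hxy⟩ := hdeg a (by have := hbip hba; tauto)
      rcases (hxy b).1 hba.symm with rfl | rfl
      · exact ⟨y, hne.symm, (hxy y).2 (Or.inr rfl), fun w => (hxy w).1⟩
      · exact ⟨x, hne, (hxy x).2 (Or.inl rfl), fun w hw => ((hxy w).1 hw).symm⟩
    refine ⟨c, hcb, hac, hc, fun u hu => ?_⟩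
    by_contra hbu
    have hcT : c ∈ T := Or.inr ⟨by have := hbip hba; have := hbip hac; tauto, hcb, u, hu, hbu⟩
    exact (hG.mem_iff_not_mem hT hac).1 (Or.inl hba) hcT
  obtain ⟨c, hcb, hpc, hpN, hcN⟩ := hother p hp
  have hbN : ∀ w, G.Adj b w → w = p ∨ w = q := by
    intro w hw
    by_contra! h
    exact hcb (hG.unique_neighbor_of_three hT hbT hp hq hw h.2.symm hpq.symm h.1 hpc)
  obtain ⟨u, w, huw, hcu, hcw⟩ := hfar p c hp hpc hcb
  have hcq : G.Adj c q := by
    rcases hbN u (hcN u hcu) with rfl | rfl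
    · rcases hbN w (hcN w hcw) with rfl | rfl
      · exact absurd rfl huw
      · exact hcw
    · exact hcu
  obtain ⟨c', -, -, hqN, -⟩ := hother q hq
  have hqN' : ∀ w, G.Adj q w → w = b ∨ w = c := by
    intro w hw
    have h1 := hqN w hw
    have h2 := (hqN c hcq.symm).resolve_left hcb
    rwa [h2]
  refine _root_.nonempty_iso_cycleGraph_four (a := b) (b := p) (c := c) (d := q)
    (hconn.forall_of_adj_closed (a := b) (Or.inl rfl) ?_) hcb.symm hpq hp hpc hcq hq.symm ?_ ?_
  · rintro x y (rfl | rfl | rfl | rfl) hxy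
    · have := hbN y hxy; tauto
    · have := hpN y hxy; tauto
    · have := hbN y (hcN y hxy); tauto
    · have := hqN' y hxy; tauto
  · intro h
    have := hbip h
    have := hbip hp
    have := hbip hpc
    tauto
  · intro h
    have := hbip h
    have := hbip hp
    have := hbip hq
    tauto

theorem MinimalDD2.star_or_cycle4_or_subdivision_corona [Finite V] (hG : MinimalDD2 G)
    (hconn : G.Connected) :
    (∃ n : ℕ, 2 ≤ n ∧ Nonempty (G ≃g completeBipartiteGraph (Fin 1) (Fin n))) ∨
      Nonempty (G ≃g SimpleGraph.cycleGraph 4) ∨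
      (∃ A B : Set V, Disjoint A B ∧ A ∪ B = Set.univ ∧
        (∀ u ∈ A, ∀ v ∈ A, ¬ G.Adj u v) ∧ (∀ u ∈ B, ∀ v ∈ B, ¬ G.Adj u v) ∧
        (∀ a ∈ A, (G.neighborSet a).ncard = 2) ∧
        (∀ b ∈ B, (G.neighborSet b).ncard = 1 ∨
          ∃ l : V, (G.neighborSet l).ncard = 1 ∧ G.dist b l = 2)) := by
  obtain ⟨S, hS⟩ := hG.1.exists_splitsDD2
  have hbip := fun {x y : V} (h : G.Adj x y) => hG.mem_iff_not_mem hS h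
  by_cases hdeg : ∀ a ∉ S, ∃ x y, x ≠ y ∧ ∀ w, G.Adj a w ↔ w = x ∨ w = y
  · refine Or.inr (or_iff_not_imp_left.2 fun hC4 => ⟨Sᶜ, S, disjoint_compl_left,
      Set.compl_union_self S, ?_, ?_, ?_, ?_⟩)
    · intro u hu v hv h
      exact hu ((hbip h).2 hv)
    · intro u hu v hv h
      exact (hbip h).1 hu hv
    · intro a ha
      obtain ⟨x, y, hne, hxy⟩ := hdeg a ha
      exact Set.ncard_eq_two.2 ⟨x, y, hne, by ext w; simp [hxy]⟩
    · intro b hb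
      have htwo : ∀ v, (G.neighborSet v).ncard ≠ 1 → ∃ u w, u ≠ w ∧ G.Adj v u ∧ G.Adj v w := by
        intro v hv
        obtain ⟨u, hu⟩ := hS.exists_adj v
        by_contra! h
        exact hv (Set.ncard_eq_one.2 ⟨u, Set.eq_singleton_iff_unique_mem.2
          ⟨hu, fun w hw => by_contra fun hne => h w u hne hw hu⟩⟩)
      by_contra! hc
      obtain ⟨p, q, hpq, hp, hq⟩ := htwo b hc.1
      refine hC4 (hG.nonempty_iso_cycleGraph_four hconn hS hdeg hb hpq hp hq ?_)
      intro a l hba hal hlb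
      refine htwo l fun hl => hc.2 l hl (SimpleGraph.dist_eq_two_iff.2
        ⟨hlb.symm, fun h => ?_, a, hba, hal.symm⟩)
      have := hbip h
      have := hbip hba
      have := hbip hal
      tauto
  · push Not at hdeg
    obtain ⟨a, ha, hdeg⟩ := hdeg
    obtain ⟨x, hx, y, hy, hxy, hax, hay⟩ := hS.2 a ha
    obtain ⟨z, hz⟩ := hdeg x y hxy
    have hz : G.Adj a z ∧ z ≠ x ∧ z ≠ y := by
      rcases hz with hz | ⟨hz, rfl | rfl⟩ <;> tauto
    have hleaf : ∀ l, G.Adj a l → ∀ u, G.Adj l u → u = a := by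
      intro l hl u hu
      obtain ⟨v, w, hvw, hvl, hwl, hav, haw⟩ :
          ∃ v w, v ≠ w ∧ v ≠ l ∧ w ≠ l ∧ G.Adj a v ∧ G.Adj a w := by
        by_cases h1 : x = l
        · exact ⟨y, z, by grind, by grind, by grind, hay, hz.1⟩
        · by_cases h2 : y = l
          · exact ⟨x, z, by grind, by grind, by grind, hax, hz.1⟩
          · exact ⟨x, y, hxy, h1, h2, hax, hay⟩
      exact hG.unique_neighbor_of_three hS ha hl hav haw hvw hvl hwl hu
    have hall : ∀ v, v = a ∨ G.Adj a v := by
      refine hconn.forall_of_adj_closed (a := a) (Or.inl rfl) ?_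
      rintro u v (rfl | hu) huv
      · exact Or.inr huv
      · exact Or.inl (hleaf u hu v huv)
    refine Or.inl (exists_iso_completeBipartiteGraph_one (a := a) (fun u hu w => ?_)
      hax.ne' hay.ne' hxy)
    have hau := (hall u).resolve_left hu
    exact ⟨hleaf u hau w, by rintro rfl; exact hau.symm⟩

end

/-- A connected graph is a minimal `DD₂`-graph iff it is a star `K_{1,n}`
with `n ≥ 2`, the cycle `C₄`, or its vertex set admits a partition into independent sets
`A`, `B` with every vertex of `A` of degree exactly 2 and every vertex of `B` a leaf or at
distance two from some leaf (i.e. it is the subdivision graph of a connected corona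
multigraph). -/
theorem minimalDD2_iff_star_or_cycle4_or_subdivision_corona {V : Type} [Fintype V]
    (G : SimpleGraph V) (hconn : G.Connected) :
    MinimalDD2 G ↔
      (∃ n : ℕ, 2 ≤ n ∧ Nonempty (G ≃g completeBipartiteGraph (Fin 1) (Fin n))) ∨
      Nonempty (G ≃g SimpleGraph.cycleGraph 4) ∨
      (∃ A B : Set V, Disjoint A B ∧ A ∪ B = Set.univ ∧
        (∀ u ∈ A, ∀ v ∈ A, ¬ G.Adj u v) ∧ (∀ u ∈ B, ∀ v ∈ B, ¬ G.Adj u v) ∧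
        (∀ a ∈ A, (G.neighborSet a).ncard = 2) ∧
        (∀ b ∈ B, (G.neighborSet b).ncard = 1 ∨
          ∃ l : V, (G.neighborSet l).ncard = 1 ∧ G.dist b l = 2)) := by
  constructor
  · exact fun h => h.star_or_cycle4_or_subdivision_corona hconn
  · rintro (⟨n, hn, ⟨e⟩⟩ | ⟨⟨e⟩⟩ | ⟨A, B, hAB, hU, hA, hB, hdeg, hcor⟩)
    · exact (minimalDD2_completeBipartiteGraph_one hn).of_iso e
    · exact minimalDD2_cycleGraph_four.of_iso e
    · exact minimalDD2_of_subdivision_corona hAB hU hA hB hdeg hcor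
end

section
/- Let G be a finite simple graph with no isolated vertex. Then G is a DD₂-graph if and only if every weak support vertex s of G has a neighbor that is neither a leaf of G nor a support vertex of G; i.e., N_G(s) ∖ (L_G ∪ S_G) ≠ ∅ for every weak support vertex s, where L_G is the set of leaves and S_G the set of support vertices of G. -/
/-- A nonempty finite set that is not a singleton has two distinct elements. -/
theorem Set.exists_ne_of_ncard_ne_one {α : Type*} [Finite α] {s : Set α} (hs : s.Nonempty)
    (h : s.ncard ≠ 1) : ∃ a ∈ s, ∃ b ∈ s, a ≠ b := by
  have hpos : 0 < s.ncard := (Set.ncard_pos).2 hs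
  exact (Set.one_lt_ncard_iff_nontrivial).1 (by omega)

/-- Any set of vertices of a finite graph contains an independent set dominating it. -/
theorem SimpleGraph.exists_independent_dominating_subset {V : Type*} [Finite V]
    (G : SimpleGraph V) (R : Set V) :
    ∃ I ⊆ R, (∀ u ∈ I, ∀ v ∈ I, ¬ G.Adj u v) ∧ ∀ v ∈ R, v ∉ I → ∃ u ∈ I, G.Adj u v := by
  obtain ⟨I, hI⟩ := (Set.toFinite
    {I : Set V | I ⊆ R ∧ ∀ u ∈ I, ∀ v ∈ I, ¬ G.Adj u v}).exists_maximal
    ⟨∅, by simp⟩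
  refine ⟨I, hI.prop.1, hI.prop.2, fun v hv hvI => ?_⟩
  by_contra! hno
  refine hvI (hI.le_of_ge (y := insert v I) ⟨Set.insert_subset hv hI.prop.1, ?_⟩
    (Set.subset_insert v I) (Set.mem_insert v I))
  rintro u (rfl | hu) w (rfl | hw) huw
  · exact huw.ne rfl
  · exact hno w hw huw.symm
  · exact hno u hu huw
  · exact hI.prop.2 u hu w hw huw

/-- A 2-dominating set contains every leaf. -/
theorem TwoDominating.mem_of_leaf {V : Type*} {G : SimpleGraph V} {D : Set V}
    (hD : TwoDominating G D) {v : V} (hv : (G.neighborSet v).ncard = 1) : v ∈ D := by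
  by_contra hvD
  obtain ⟨u, -, w, -, huw, hu, hw⟩ := hD v hvD
  obtain ⟨a, ha⟩ := Set.ncard_eq_one.1 hv
  have hu' : u ∈ G.neighborSet v := hu.symm
  have hw' : w ∈ G.neighborSet v := hw.symm
  rw [ha] at hu' hw'
  exact huw (hu'.trans hw'.symm)

/-- A graph with no isolated vertex is a `DD₂`-graph iff every weak
support vertex `s` (a vertex with exactly one leaf neighbor) has a neighbor that is
neither a leaf nor a support vertex. -/
theorem isDD2_iff_weak_support_condition {V : Type} [Fintype V] (G : SimpleGraph V)
    (hiso : ∀ v : V, (G.neighborSet v).Nonempty) :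
    IsDD2 G ↔
      ∀ s : V, {u | G.Adj s u ∧ (G.neighborSet u).ncard = 1}.ncard = 1 →
        (G.neighborSet s \
          ({v | (G.neighborSet v).ncard = 1} ∪
           {v | ∃ u, G.Adj v u ∧ (G.neighborSet u).ncard = 1})).Nonempty := by
  have leaf_unique : ∀ {v a b : V}, (G.neighborSet v).ncard = 1 → G.Adj v a → G.Adj v b →
      a = b := by
    intro v a b hv ha hb
    exact (Set.ncard_le_one_iff).1 hv.le ha hb
  constructor
  · rintro ⟨D, D2, hdisj, hD, hD2⟩ s hs
    have support_mem : ∀ v u, G.Adj v u → (G.neighborSet u).ncard = 1 → v ∈ D := by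
      intro v u hvu hu
      obtain ⟨w, hw, hwu⟩ := hD u fun h => hdisj.notMem_of_mem_left h (hD2.mem_of_leaf hu)
      rwa [leaf_unique hu hvu.symm hwu.symm]
    obtain ⟨l, hl⟩ := Set.ncard_eq_one.1 hs
    have hls : G.Adj s l ∧ (G.neighborSet l).ncard = 1 := hl.ge rfl
    obtain ⟨a, ha, b, hb, hab, has, hbs⟩ :=
      hD2 s (hdisj.notMem_of_mem_left (support_mem s l hls.1 hls.2))
    have key : ∀ c ∈ D2, G.Adj c s → c ≠ l → (G.neighborSet s \
          ({v | (G.neighborSet v).ncard = 1} ∪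
           {v | ∃ u, G.Adj v u ∧ (G.neighborSet u).ncard = 1})).Nonempty := by
      intro c hc hcs hcl
      refine ⟨c, hcs.symm, ?_⟩
      rintro (h | ⟨u, hcu, hu⟩)
      · exact hcl (hl.le ⟨hcs.symm, h⟩)
      · exact hdisj.notMem_of_mem_left (support_mem c u hcu hu) hc
    by_cases hal : a = l
    · exact key b hb hbs fun h => hab (hal.trans h.symm)
    · exact key a ha has hal
  · intro h
    have leaf_not_support : ∀ v u, (G.neighborSet v).ncard = 1 → G.Adj v u →
        (G.neighborSet u).ncard ≠ 1 := by
      intro v u hv hvu hu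
      obtain ⟨w, hw, hw'⟩ := h v <| Set.ncard_eq_one.2 ⟨u, Set.ext fun x =>
        ⟨fun hx => leaf_unique hv hx.1 hvu, by rintro rfl; exact ⟨hvu, hu⟩⟩⟩
      exact hw' (Or.inl (leaf_unique hv hw hvu ▸ hu))
    set S : Set V := {v | ∃ u, G.Adj v u ∧ (G.neighborSet u).ncard = 1}
    obtain ⟨I, hIR, hind, hdom⟩ := G.exists_independent_dominating_subset
      {v | (G.neighborSet v).ncard ≠ 1 ∧ v ∉ S ∧ ∀ s ∈ S, ¬ G.Adj s v}
    have leaf_notMem : ∀ v, (G.neighborSet v).ncard = 1 → v ∉ S ∪ I := by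
      rintro v hv (⟨u, hvu, hu⟩ | hvI)
      · exact leaf_not_support v u hv hvu hu
      · exact (hIR hvI).1 hv
    refine ⟨S ∪ I, (S ∪ I)ᶜ, disjoint_compl_right, ?_, ?_⟩
    · intro v hv
      by_cases hleaf : (G.neighborSet v).ncard = 1
      · obtain ⟨u, hu⟩ := hiso v
        exact ⟨u, Or.inl ⟨v, hu.symm, hleaf⟩, hu.symm⟩
      · by_cases hvS : ∃ s ∈ S, G.Adj s v
        · obtain ⟨s, hs, hsv⟩ := hvS
          exact ⟨s, Or.inl hs, hsv⟩
        · push Not at hvS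
          obtain ⟨u, hu, huv⟩ := hdom v ⟨hleaf, fun h => hv (Or.inl h), hvS⟩
            fun h => hv (Or.inr h)
          exact ⟨u, Or.inr hu, huv⟩
    · intro v hv
      rcases not_not.1 hv with hvS | hvI
      · by_cases hweak : {u | G.Adj v u ∧ (G.neighborSet u).ncard = 1}.ncard = 1
        · obtain ⟨w, hvw, hw⟩ := h v hweak
          obtain ⟨l, hvl, hl⟩ := hvS
          refine ⟨l, leaf_notMem l hl, w, ?_, ?_, hvl.symm, hvw.symm⟩
          · rintro (hwS | hwI)
            · exact hw (Or.inr hwS)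
            · exact (hIR hwI).2.2 v ⟨l, hvl, hl⟩ hvw
          · rintro rfl
            exact hw (Or.inl hl)
        · obtain ⟨a, ha, b, hb, hab⟩ := Set.exists_ne_of_ncard_ne_one hvS hweak
          exact ⟨a, leaf_notMem a ha.2, b, leaf_notMem b hb.2, hab, ha.1.symm, hb.1.symm⟩
      · obtain ⟨a, ha, b, hb, hab⟩ := Set.exists_ne_of_ncard_ne_one (hiso v) (hIR hvI).1
        have neighbor_notMem : ∀ c, G.Adj v c → c ∈ (S ∪ I)ᶜ := by
          rintro c hvc (hcS | hcI)
          · exact (hIR hvI).2.2 c hcS hvc.symm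
          · exact hind v hvI c hcI hvc
        exact ⟨a, neighbor_notMem a ha, b, neighbor_notMem b hb, hab, ha.symm, hb.symm⟩
end

section
/- Let G be a finite simple graph on n vertices with minimum degree δ ≥ 1 and maximum degree Δ. Then every induced matching M in G satisfies |M| ≤ nΔ / (2(Δ + δ − 1)). -/
/-- In a graph on `n` vertices with minimum degree `δ ≥ 1` and maximum
degree `Δ`, every induced matching `M` satisfies `|M| ≤ nΔ / (2(Δ + δ - 1))`. -/
theorem induced_matching_card_le {V : Type} [Fintype V] [DecidableEq V] [Nonempty V]
    (G : SimpleGraph V) [DecidableRel G.Adj]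
    (hδ : 1 ≤ G.minDegree)
    (M : Set (Sym2 V))
    (hsub : M ⊆ G.edgeSet)
    (hmatch : ∀ e ∈ M, ∀ f ∈ M, e ≠ f → ∀ v : V, ¬ (v ∈ e ∧ v ∈ f))
    (hind : ∀ e ∈ G.edgeSet, (∀ v ∈ e, ∃ f ∈ M, v ∈ f) → e ∈ M) :
    2 * (G.maxDegree + G.minDegree - 1) * M.ncard ≤ Fintype.card V * G.maxDegree := by
  classical
  set F := M.toFinset with hF
  have hMF : M.ncard = F.card := Set.ncard_eq_toFinset_card' M
  let S : Finset V := F.biUnion Sym2.toFinset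
  have memS : ∀ v, v ∈ S ↔ ∃ f ∈ M, v ∈ f := by
    intro v
    simp [S, hF]
  have hS : S.card = 2 * F.card := by
    rw [Finset.card_biUnion, Finset.sum_const_nat (m := 2), mul_comm]
    · intro e he
      exact Sym2.card_toFinset_of_not_isDiag e
        (G.not_isDiag_of_mem_edgeSet (hsub (by simpa [hF] using he)))
    · intro e he f hf hef
      rw [Function.onFun, Finset.disjoint_left]
      intro v hve hvf
      exact hmatch e (by simpa [hF] using he) f (by simpa [hF] using hf) hef v
        ⟨by simpa using hve, by simpa using hvf⟩
  have hdeg : ∀ v ∈ S, G.minDegree - 1 ≤ (Sᶜ.bipartiteAbove G.Adj v).card := by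
    intro v hv
    have hone : (S.bipartiteAbove G.Adj v).card ≤ 1 := by
      rw [Finset.card_le_one]
      intro a ha b hb
      rw [Finset.mem_bipartiteAbove] at ha hb
      have key : ∀ w, w ∈ S ∧ G.Adj v w → s(v, w) ∈ M := by
        rintro w ⟨hw, hvw⟩
        refine hind _ hvw fun u hu => ?_
        rcases Sym2.mem_iff.1 hu with rfl | rfl
        · exact (memS _).1 hv
        · exact (memS _).1 hw
      by_contra hab
      refine hmatch _ (key a ha) _ (key b hb) (fun h => hab (Sym2.congr_right.1 h)) v
        ⟨Sym2.mem_mk_left _ _, Sym2.mem_mk_left _ _⟩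
    have hsplit : G.degree v =
        (S.bipartiteAbove G.Adj v).card + (Sᶜ.bipartiteAbove G.Adj v).card := by
      rw [← Finset.card_union_of_disjoint, ← G.card_neighborFinset_eq_degree]
      · congr 1
        ext w
        simp only [SimpleGraph.mem_neighborFinset, Finset.mem_union,
          Finset.mem_bipartiteAbove, Finset.mem_compl]
        tauto
      · exact Finset.disjoint_filter_filter disjoint_compl_right
    have := G.minDegree_le_degree v
    omega
  have hcount : S.card * (G.minDegree - 1) ≤ Sᶜ.card * G.maxDegree := by
    refine Finset.card_mul_le_card_mul G.Adj hdeg fun b _ => ?_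
    refine le_trans (Finset.card_le_card fun w hw => ?_) (G.degree_le_maxDegree b)
    rw [Finset.mem_bipartiteBelow] at hw
    simpa using hw.2.symm
  have hcard : S.card + Sᶜ.card = Fintype.card V := Finset.card_add_card_compl S
  rw [Nat.add_sub_assoc hδ, hMF, ← hcard]
  calc 2 * (G.maxDegree + (G.minDegree - 1)) * F.card
      = S.card * G.maxDegree + S.card * (G.minDegree - 1) := by rw [hS]; ring
    _ ≤ S.card * G.maxDegree + Sᶜ.card * G.maxDegree := by gcongr
    _ = (S.card + Sᶜ.card) * G.maxDegree := by ring
end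

section
/- Every minimal DD₂-graph on n vertices has at most 2(n − 2) edges. (Each connected component, being a star K_{1,t} with t ≥ 2, a cycle C₄, or a subdivision graph of a connected corona multigraph on n' vertices, has at most 2(n' − 2) edges.) -/
theorem TwoDominating.mono {V : Type*} {G : SimpleGraph V} {S T : Set V}
    (hS : TwoDominating G S) (hST : S ⊆ T) : TwoDominating G T := by
  intro v hv
  obtain ⟨u, hu, w, hw, h⟩ := hS v fun h => hv (hST h)
  exact ⟨u, hST hu, w, hST hw, h⟩

/-- A `DD₂`-graph has a dominating set whose complement is 2-dominating. -/
theorem IsDD2.exists_compl {V : Type*} {G : SimpleGraph V} (hG : IsDD2 G) :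
    ∃ D : Set V, Dominating G D ∧ TwoDominating G Dᶜ := by
  obtain ⟨D, D2, hdisj, hD, hD2⟩ := hG
  exact ⟨D, hD, hD2.mono hdisj.subset_compl_left⟩

/-- A nonempty `DD₂`-graph has a spanning `DD₂`-subgraph with at most `2(n - 2)` edges. -/
theorem IsDD2.exists_le_ncard_edgeSet_le {V : Type*} [Fintype V] [Nonempty V]
    {G : SimpleGraph V} (hG : IsDD2 G) :
    ∃ H ≤ G, IsDD2 H ∧ H.edgeSet.ncard ≤ 2 * (Fintype.card V - 2) := by
  classical
  obtain ⟨S, hS, hS2⟩ := hG.exists_compl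
  obtain ⟨D, rfl⟩ : ∃ D : Finset V, (D : Set V) = S := ⟨S.toFinset, by simp⟩
  have hdom : ∀ v, ∃ u, v ∉ D → u ∈ D ∧ G.Adj u v := fun v => by
    by_cases hv : v ∈ D
    · exact ⟨v, fun h => absurd hv h⟩
    · obtain ⟨u, hu, h⟩ := hS v (by simpa using hv)
      exact ⟨u, fun _ => ⟨by simpa using hu, h⟩⟩
  have htwo : ∀ v, ∃ u w, v ∈ D → u ∉ D ∧ w ∉ D ∧ u ≠ w ∧ G.Adj u v ∧ G.Adj w v := fun v => by
    by_cases hv : v ∈ D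
    · obtain ⟨u, hu, w, hw, h⟩ := hS2 v (by simpa using hv)
      exact ⟨u, w, fun _ => ⟨by simpa using hu, by simpa using hw, h⟩⟩
    · exact ⟨v, v, fun h => absurd h hv⟩
  choose h hh using hdom
  choose f g hfg using htwo
  obtain ⟨d, hd⟩ : ∃ d, d ∈ D := by
    obtain ⟨v⟩ := ‹Nonempty V›
    by_cases hv : v ∈ D
    · exact ⟨v, hv⟩
    · exact ⟨h v, (hh v hv).1⟩
  obtain ⟨hfd, hgd, hne, -, -⟩ := hfg d hd
  have hsub : ({f d, g d} : Finset V) ⊆ Dᶜ := by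
    simp [Finset.insert_subset_iff, hfd, hgd]
  set E : Finset (Sym2 V) := D.image (fun v => s(f v, v)) ∪ D.image (fun v => s(g v, v)) ∪
    (Dᶜ \ {f d, g d}).image (fun v => s(h v, v)) with hE
  have hfE : ∀ v ∈ D, s(f v, v) ∈ E := fun v hv =>
    Finset.mem_union_left _ (Finset.mem_union_left _ (Finset.mem_image_of_mem _ hv))
  have hgE : ∀ v ∈ D, s(g v, v) ∈ E := fun v hv =>
    Finset.mem_union_left _ (Finset.mem_union_right _ (Finset.mem_image_of_mem _ hv))
  have hEG : (E : Set (Sym2 V)) ⊆ G.edgeSet := by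
    intro e he
    simp only [hE, Finset.coe_union, Set.mem_union, Finset.mem_coe, Finset.mem_image,
      Finset.mem_sdiff, Finset.mem_compl] at he
    rcases he with (⟨v, hv, rfl⟩ | ⟨v, hv, rfl⟩) | ⟨v, hv, rfl⟩
    · exact (hfg v hv).2.2.2.1
    · exact (hfg v hv).2.2.2.2
    · exact (hh v hv.1).2
  have hadj : ∀ u v, s(u, v) ∈ E → (SimpleGraph.fromEdgeSet (E : Set (Sym2 V))).Adj u v :=
    fun u v huv => (SimpleGraph.fromEdgeSet_adj _).2
      ⟨huv, G.ne_of_adj (hEG huv)⟩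
  refine ⟨SimpleGraph.fromEdgeSet (E : Set (Sym2 V)), ?_, ⟨D, (D : Set V)ᶜ, disjoint_compl_right,
    ?_, ?_⟩, ?_⟩
  · intro u v huv
    exact hEG ((SimpleGraph.fromEdgeSet_adj _).1 huv).1
  · intro v hv
    have hv' : v ∉ D := by simpa using hv
    by_cases hvd : v = f d ∨ v = g d
    · refine ⟨d, hd, (hadj v d ?_).symm⟩
      rcases hvd with rfl | rfl
      · exact hfE d hd
      · exact hgE d hd
    · refine ⟨h v, (hh v hv').1, hadj _ _ (Finset.mem_union_right _
        (Finset.mem_image_of_mem _ ?_))⟩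
      simpa [hv'] using hvd
  · intro v hv
    have hv' : v ∈ D := by simpa using hv
    obtain ⟨hf, hg, hvne, -, -⟩ := hfg v hv'
    exact ⟨f v, hf, g v, hg, hvne, hadj _ _ (hfE v hv'), hadj _ _ (hgE v hv')⟩
  · have hle : (SimpleGraph.fromEdgeSet (E : Set (Sym2 V))).edgeSet.ncard ≤ E.card := by
      rw [← Set.ncard_coe_finset E, SimpleGraph.edgeSet_fromEdgeSet]
      exact Set.ncard_le_ncard Set.sdiff_subset E.finite_toSet
    have hcard : E.card ≤ D.card + D.card + (Dᶜ \ {f d, g d}).card :=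
      (Finset.card_union_le _ _).trans (Nat.add_le_add ((Finset.card_union_le _ _).trans
        (Nat.add_le_add Finset.card_image_le Finset.card_image_le)) Finset.card_image_le)
    have hsdiff := Finset.card_sdiff_add_card_eq_card hsub
    have hpair := Finset.card_pair hne
    have hcompl := D.card_add_card_compl
    omega

/-- Every minimal `DD₂`-graph on `n` vertices has at most `2(n - 2)`
edges. -/
theorem minimalDD2_edge_upper_bound {V : Type} [Fintype V] (G : SimpleGraph V)
    (hG : MinimalDD2 G) :
    G.edgeSet.ncard ≤ 2 * (Fintype.card V - 2) := by
  rcases isEmpty_or_nonempty V with hV | hV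
  · have : G.edgeSet = ∅ := Set.eq_empty_of_forall_notMem fun e => by
      induction e with | h u v => exact isEmptyElim u
    simp [this]
  · obtain ⟨H, hHG, hH, hcard⟩ := hG.1.exists_le_ncard_edgeSet_le
    obtain rfl | hlt := hHG.eq_or_lt
    · exact hcard
    · exact absurd hH (hG.2 H hlt)
end

section
/- Let G be a DD₂-graph on n vertices, let H be any minimal spanning DD₂-subgraph of G, and let H* be a minimal spanning DD₂-subgraph of G of minimum number of edges. Then |E(H)| < 3·|E(H*)|. (Hence any minimal spanning DD₂-subgraph is a factor-3 approximation for the minimum-size minimal spanning DD₂-subgraph problem.) -/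
/-- A vertex set witnessing that a graph is a `DD₂`-graph, together with chosen neighbors `f v`
for every vertex and second neighbors `g v` for the vertices outside the set. -/
structure DD2Choice {V : Type*} (G : SimpleGraph V) (S : Set V) (f g : V → V) : Prop where
  adj : ∀ v, G.Adj v (f v)
  mem : ∀ v, v ∈ S ↔ f v ∉ S
  adj' : ∀ v ∉ S, G.Adj v (g v)
  mem' : ∀ v ∉ S, g v ∈ S
  ne : ∀ v ∉ S, f v ≠ g v

theorem IsDD2.exists_choice {V : Type*} {G : SimpleGraph V} (h : IsDD2 G) :
    ∃ S f g, DD2Choice G S f g := by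
  obtain ⟨D, S, hd, hD, hS⟩ := h
  have key : ∀ v, ∃ u w, G.Adj v u ∧ (v ∈ S ↔ u ∉ S) ∧
      (v ∉ S → G.Adj v w ∧ w ∈ S ∧ u ≠ w) := by
    intro v
    by_cases hv : v ∈ S
    · obtain ⟨u, hu, huv⟩ := hD v (hd.notMem_of_mem_right hv)
      have huS := hd.notMem_of_mem_left hu
      exact ⟨u, u, huv.symm, by tauto, by tauto⟩
    · obtain ⟨u, hu, w, hw, hne, hua, hwa⟩ := hS v hv
      exact ⟨u, w, hua.symm, by tauto, fun _ => ⟨hwa.symm, hw, hne⟩⟩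
  choose f g hfg using key
  exact ⟨S, f, g, fun v => (hfg v).1, fun v => (hfg v).2.1, fun v hv => ((hfg v).2.2 hv).1,
    fun v hv => ((hfg v).2.2 hv).2.1, fun v hv => ((hfg v).2.2 hv).2.2⟩

namespace DD2Choice

variable {V : Type*} {G : SimpleGraph V} {S : Set V} {f g : V → V}

theorem isDD2 (h : DD2Choice G S f g) : IsDD2 G := by
  refine ⟨Sᶜ, S, disjoint_compl_left, fun v hv => ⟨f v, ?_, (h.adj v).symm⟩, fun v hv =>
    ⟨f v, ?_, g v, h.mem' v hv, h.ne v hv, (h.adj v).symm, (h.adj' v hv).symm⟩⟩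
  · exact (h.mem v).1 (by simpa using hv)
  · have := h.mem v
    tauto

/-- The edges selected by a choice of neighbors. -/
def edges (S : Set V) (f g : V → V) : Set (Sym2 V) :=
  Set.range (fun v => s(v, f v)) ∪ (fun v => s(v, g v)) '' Sᶜ

theorem restrict (h : DD2Choice G S f g) :
    DD2Choice (SimpleGraph.fromEdgeSet (edges S f g)) S f g where
  adj v := by
    rw [SimpleGraph.fromEdgeSet_adj]
    exact ⟨Or.inl ⟨v, rfl⟩, (h.adj v).ne⟩
  mem := h.mem
  adj' v hv := by
    rw [SimpleGraph.fromEdgeSet_adj]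
    exact ⟨Or.inr ⟨v, hv, rfl⟩, (h.adj' v hv).ne⟩
  mem' := h.mem'
  ne := h.ne

theorem edges_subset (h : DD2Choice G S f g) : edges S f g ⊆ G.edgeSet := by
  rintro _ (⟨v, rfl⟩ | ⟨v, hv, rfl⟩)
  · exact h.adj v
  · exact h.adj' v hv

theorem two_mul_card_le [Finite V] (h : DD2Choice G S f g) :
    2 * Nat.card V ≤ 3 * G.edgeSet.ncard := by
  have hfin : G.edgeSet.Finite := Set.toFinite _
  have hS : S.ncard ≤ G.edgeSet.ncard := by
    refine Set.ncard_le_ncard_of_injOn (fun v => s(v, f v)) (fun v _ => h.adj v) ?_ hfin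
    intro v hv w hw hvw
    have := (h.mem w).1 hw
    rcases Sym2.eq_iff.1 hvw with ⟨e, -⟩ | ⟨e, -⟩
    · exact e
    · exact absurd (e ▸ hv) this
  have hinj : ∀ k : V → V, (∀ v ∉ S, k v ∈ S) → Set.InjOn (fun v => s(v, k v)) Sᶜ := by
    intro k hk v hv w hw hvw
    rcases Sym2.eq_iff.1 hvw with ⟨e, -⟩ | ⟨e, -⟩
    · exact e
    · exact absurd (e ▸ hk w hw) hv
  have hf : ∀ v ∉ S, f v ∈ S := fun v hv => by
    have := h.mem v
    tauto
  have hdisj : Disjoint ((fun v => s(v, f v)) '' Sᶜ) ((fun v => s(v, g v)) '' Sᶜ) := by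
    rw [Set.disjoint_left]
    rintro _ ⟨v, hv, rfl⟩ ⟨w, hw, hvw⟩
    rcases Sym2.eq_iff.1 hvw with ⟨rfl, e⟩ | ⟨e, -⟩
    · exact h.ne w hw e.symm
    · exact hw (e ▸ hf v hv)
  have hSc : Sᶜ.ncard + Sᶜ.ncard ≤ G.edgeSet.ncard := by
    nth_rewrite 1 [← (hinj f hf).ncard_image]
    rw [← (hinj g h.mem').ncard_image, ← Set.ncard_union_eq hdisj]
    refine Set.ncard_le_ncard (Set.Subset.trans ?_ h.edges_subset) hfin
    exact Set.union_subset_union_left _ (Set.image_subset_range _ _)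
  have := Set.ncard_add_ncard_compl S
  omega

theorem ncard_edges_lt [Finite V] [Nonempty V] (h : DD2Choice G S f g) :
    (edges S f g).ncard < 2 * Nat.card V := by
  have hne : S.Nonempty := by
    obtain ⟨v⟩ := ‹Nonempty V›
    by_cases hv : v ∈ S
    · exact ⟨v, hv⟩
    · exact ⟨f v, not_not.1 fun hf => hv ((h.mem v).2 hf)⟩
  have hpos := (Set.ncard_pos S.toFinite).2 hne
  have hcard := Set.ncard_add_ncard_compl S
  have hrange : (Set.range fun v => s(v, f v)).ncard ≤ Nat.card V := by
    rw [← Set.image_univ, ← Set.ncard_univ]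
    exact Set.ncard_image_le
  have himage : ((fun v => s(v, g v)) '' Sᶜ).ncard ≤ Sᶜ.ncard := Set.ncard_image_le
  have : (edges S f g).ncard ≤ _ := Set.ncard_union_le _ _
  omega

end DD2Choice

theorem MinimalDD2.ncard_edgeSet_lt {V : Type*} [Finite V] [Nonempty V] {G : SimpleGraph V}
    (h : MinimalDD2 G) : G.edgeSet.ncard < 2 * Nat.card V := by
  obtain ⟨S, f, g, hc⟩ := h.1.exists_choice
  have hle : SimpleGraph.fromEdgeSet (DD2Choice.edges S f g) ≤ G := fun v w hvw =>
    hc.edges_subset ((SimpleGraph.fromEdgeSet_adj _).1 hvw).1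
  have heq := hle.eq_of_not_lt fun hlt => h.2 _ hlt hc.restrict.isDD2
  refine lt_of_le_of_lt (Set.ncard_le_ncard ?_ (Set.toFinite _)) hc.ncard_edges_lt
  rw [← heq, SimpleGraph.edgeSet_fromEdgeSet]
  exact Set.sdiff_subset


/-- If `G` is a `DD₂`-graph, `H` is any minimal spanning `DD₂`-subgraph
of `G` and `Hstar` is a minimal spanning `DD₂`-subgraph of `G` with the minimum number
of edges, then `|E(H)| < 3|E(Hstar)|`. -/
theorem min_DD2_three_approx {V : Type} [Fintype V] [Nonempty V]
    (G H Hstar : SimpleGraph V)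
    (hG : IsDD2 G)
    (hHle : H ≤ G) (hHmin : MinimalDD2 H)
    (hSle : Hstar ≤ G) (hSmin : MinimalDD2 Hstar)
    (hopt : ∀ H' : SimpleGraph V, H' ≤ G → MinimalDD2 H' →
      Hstar.edgeSet.ncard ≤ H'.edgeSet.ncard) :
    H.edgeSet.ncard < 3 * Hstar.edgeSet.ncard := by
  obtain ⟨S, f, g, hc⟩ := hSmin.1.exists_choice
  exact hHmin.ncard_edgeSet_lt.trans_le hc.two_mul_card_le
end

section
/- Let G be a 3-regular graph, let M be an inclusion-maximal induced matching in G, let A' be the set of vertices covered by M, let T = V(G) ∖ (A' ∪ N(A')), let A = A' ∪ T, and let B = V(G) ∖ A. Then T is an independent set, every vertex of A' has exactly two neighbors in B, every vertex of T has all three of its neighbors in B, A is a dominating set of G, and B is a 2-dominating set of G. -/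
/-- A vertex covered by an induced matching is adjacent to exactly one covered vertex,
its partner. -/
theorem covered_neighbor_unique {V : Type*} {G : SimpleGraph V} {M : Set (Sym2 V)}
    (hmatch : ∀ e ∈ M, ∀ f ∈ M, e ≠ f → ∀ v : V, ¬ (v ∈ e ∧ v ∈ f))
    (hind : ∀ e ∈ G.edgeSet, (∀ v ∈ e, ∃ f ∈ M, v ∈ f) → e ∈ M)
    {v w x : V} (hvw : s(v, w) ∈ M) (hx : ∃ f ∈ M, x ∈ f) (hvx : G.Adj v x) : x = w := by
  have hvxM : s(v, x) ∈ M := by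
    refine hind _ hvx fun y hy => ?_
    rcases Sym2.mem_iff.1 hy with rfl | rfl
    · exact ⟨_, hvw, Sym2.mem_mk_left _ _⟩
    · exact hx
  by_contra hne
  exact hmatch _ hvxM _ hvw (fun h => hne (Sym2.congr_right.1 h)) v
    ⟨Sym2.mem_mk_left _ _, Sym2.mem_mk_left _ _⟩

/-- If `M` is a maximal induced matching, then two vertices that are neither covered nor
adjacent to a covered vertex are not adjacent. -/
theorem not_adj_of_maximal_inducedMatching {V : Type*} {G : SimpleGraph V}
    {M : Set (Sym2 V)} (hsub : M ⊆ G.edgeSet)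
    (hmatch : ∀ e ∈ M, ∀ f ∈ M, e ≠ f → ∀ v : V, ¬ (v ∈ e ∧ v ∈ f))
    (hind : ∀ e ∈ G.edgeSet, (∀ v ∈ e, ∃ f ∈ M, v ∈ f) → e ∈ M)
    (hmax : ∀ M' : Set (Sym2 V), M' ⊆ G.edgeSet →
      (∀ e ∈ M', ∀ f ∈ M', e ≠ f → ∀ v : V, ¬ (v ∈ e ∧ v ∈ f)) →
      (∀ e ∈ G.edgeSet, (∀ v ∈ e, ∃ f ∈ M', v ∈ f) → e ∈ M') →
      M ⊆ M' → M' = M)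
    {u v : V} (hu : ¬ ∃ e ∈ M, u ∈ e) (hv : ¬ ∃ e ∈ M, v ∈ e)
    (hu' : ∀ x, G.Adj u x → ¬ ∃ e ∈ M, x ∈ e) (hv' : ∀ x, G.Adj v x → ¬ ∃ e ∈ M, x ∈ e) :
    ¬ G.Adj u v := by
  intro huv
  have huncov : ∀ x ∈ s(u, v), ¬ ∃ e ∈ M, x ∈ e := by
    intro x hx
    rcases Sym2.mem_iff.1 hx with rfl | rfl <;> assumption
  have hcov : ∀ {x}, (∃ f ∈ insert s(u, v) M, x ∈ f) →
      x = u ∨ x = v ∨ ∃ f ∈ M, x ∈ f := by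
    rintro x ⟨f, rfl | hf, hx⟩
    · rcases Sym2.mem_iff.1 hx with h | h
      · exact Or.inl h
      · exact Or.inr (Or.inl h)
    · exact Or.inr (Or.inr ⟨f, hf, hx⟩)
  refine hu ⟨s(u, v), ?_, Sym2.mem_mk_left _ _⟩
  rw [← hmax (insert s(u, v) M) (Set.insert_subset huv hsub) ?_ ?_ (Set.subset_insert _ _)]
  · exact Set.mem_insert _ _
  · rintro e (rfl | he) f (rfl | hf) hne x ⟨hxe, hxf⟩
    · exact hne rfl
    · exact huncov x hxe ⟨f, hf, hxf⟩
    · exact huncov x hxf ⟨e, he, hxe⟩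
    · exact hmatch e he f hf hne x ⟨hxe, hxf⟩
  · intro e he h
    induction e using Sym2.ind with
    | _ a b =>
      have hab : G.Adj a b := he
      rcases hcov (h a (Sym2.mem_mk_left _ _)) with rfl | rfl | ha <;>
        rcases hcov (h b (Sym2.mem_mk_right _ _)) with rfl | rfl | hb
      · exact (hab.ne rfl).elim
      · exact Set.mem_insert _ _
      · exact (hu' _ hab hb).elim
      · exact Or.inl Sym2.eq_swap
      · exact (hab.ne rfl).elim
      · exact (hv' _ hab hb).elim
      · exact (hu' _ hab.symm ha).elim
      · exact (hv' _ hab.symm ha).elim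
      · refine Or.inr (hind _ he fun y hy => ?_)
        rcases Sym2.mem_iff.1 hy with rfl | rfl <;> assumption

/-- Correctness of the partition produced by the greedy algorithm on a
3-regular graph: if `M` is an inclusion-maximal induced matching, `A'` its covered
vertices, `T = V ∖ (A' ∪ N(A'))`, `A = A' ∪ T` and `B = V ∖ A`, then `T` is independent,
every vertex of `A'` has exactly two neighbors in `B`, every vertex of `T` has all its
(three) neighbors in `B`, `A` is dominating and `B` is 2-dominating. -/
theorem approx_min_DD2_partition_properties {V : Type} [Fintype V] (G : SimpleGraph V)
    (hreg : ∀ v : V, (G.neighborSet v).ncard = 3)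
    (M : Set (Sym2 V))
    (hsub : M ⊆ G.edgeSet)
    (hmatch : ∀ e ∈ M, ∀ f ∈ M, e ≠ f → ∀ v : V, ¬ (v ∈ e ∧ v ∈ f))
    (hind : ∀ e ∈ G.edgeSet, (∀ v ∈ e, ∃ f ∈ M, v ∈ f) → e ∈ M)
    (hmax : ∀ M' : Set (Sym2 V), M' ⊆ G.edgeSet →
      (∀ e ∈ M', ∀ f ∈ M', e ≠ f → ∀ v : V, ¬ (v ∈ e ∧ v ∈ f)) →
      (∀ e ∈ G.edgeSet, (∀ v ∈ e, ∃ f ∈ M', v ∈ f) → e ∈ M') →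
      M ⊆ M' → M' = M)
    (A' T A B : Set V)
    (hA' : A' = {v : V | ∃ e ∈ M, v ∈ e})
    (hT : T = Set.univ \ (A' ∪ {v : V | ∃ u ∈ A', G.Adj u v}))
    (hA : A = A' ∪ T)
    (hB : B = Set.univ \ A) :
    (∀ u ∈ T, ∀ v ∈ T, ¬ G.Adj u v) ∧
    (∀ v ∈ A', (G.neighborSet v ∩ B).ncard = 2) ∧
    (∀ v ∈ T, G.neighborSet v ⊆ B) ∧
    Dominating G A ∧ TwoDominating G B := by
  have memT : ∀ {v}, v ∈ T ↔ v ∉ A' ∧ ∀ x, G.Adj v x → x ∉ A' := by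
    intro v
    simp only [hT, Set.mem_sdiff, Set.mem_univ, true_and, Set.mem_union, Set.mem_ofPred_eq,
      not_or, not_exists, not_and]
    exact and_congr_right fun _ =>
      ⟨fun h x hvx hx => h x hx hvx.symm, fun h x hx hxv => h x hxv.symm hx⟩
  have memB : ∀ {v}, v ∈ B ↔ v ∉ A' ∧ v ∉ T := by
    intro v
    simp [hB, hA]
  have memA' : ∀ {v}, v ∈ A' ↔ ∃ e ∈ M, v ∈ e := by
    intro v
    simp [hA']
  have hTind : ∀ u ∈ T, ∀ v ∈ T, ¬ G.Adj u v := by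
    intro u hu v hv
    simp only [memT, memA'] at hu hv
    exact not_adj_of_maximal_inducedMatching hsub hmatch hind hmax hu.1 hv.1 hu.2 hv.2
  have hA'B : ∀ v ∈ A', (G.neighborSet v ∩ B).ncard = 2 := by
    intro v hv
    obtain ⟨e, he, hve⟩ := memA'.1 hv
    obtain ⟨w, rfl⟩ := hve
    have hinter : G.neighborSet v ∩ B = G.neighborSet v \ {w} := by
      ext x
      refine and_congr_right fun hvx => ?_
      rw [memB, Set.mem_singleton_iff]
      constructor
      · rintro ⟨hx, -⟩ rfl
        exact hx (memA'.2 ⟨_, he, Sym2.mem_mk_right _ _⟩)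
      · exact fun hxw =>
          ⟨fun hx => hxw (covered_neighbor_unique hmatch hind he (memA'.1 hx) hvx),
            fun hx => (memT.1 hx).2 v (G.adj_symm hvx) hv⟩
    have hw : w ∈ G.neighborSet v := hsub he
    rw [hinter, Set.ncard_sdiff_singleton_of_mem hw, hreg]
  have hTB : ∀ v ∈ T, G.neighborSet v ⊆ B := fun v hv x hvx =>
    memB.2 ⟨(memT.1 hv).2 x hvx, fun hx => hTind v hv x hx hvx⟩
  refine ⟨hTind, hA'B, hTB, ?_, ?_⟩
  · intro v hv
    simp only [hA, Set.mem_union, not_or, memT, not_and, not_forall, not_not] at hv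
    obtain ⟨x, hvx, hx⟩ := hv.2 hv.1
    exact ⟨x, hA ▸ Or.inl hx, hvx.symm⟩
  · intro v hv
    have hcard : 1 < (G.neighborSet v ∩ B).ncard := by
      by_cases hvA : v ∈ A'
      · rw [hA'B v hvA]
        norm_num
      · have hvT : v ∈ T := by
          by_contra hvT
          exact hv (memB.2 ⟨hvA, hvT⟩)
        rw [Set.inter_eq_left.2 (hTB v hvT), hreg]
        norm_num
    obtain ⟨x, hx, y, hy, hxy⟩ := (Set.one_lt_ncard).1 hcard
    exact ⟨x, hx.2, y, hy.2, hxy, G.adj_symm hx.1, G.adj_symm hy.1⟩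
end

section
/- Every 3-regular graph G on n vertices has a minimal spanning DD₂-subgraph H with |E(H)| ≤ 6n/5. -/
open Finset in
/-- If `a` and `b` pick two distinct neighbors of every vertex of `D` and all degrees are at
most `k`, then the vertices picked number at least `2 * #D / k`. -/
theorem two_mul_card_le_mul_card_image_union {V : Type*} [Fintype V] [DecidableEq V]
    (G : SimpleGraph V) {k : ℕ} (hdeg : ∀ v : V, (G.neighborSet v).ncard ≤ k)
    (D : Finset V) (a b : V → V) (ha : ∀ v ∈ D, G.Adj v (a v)) (hb : ∀ v ∈ D, G.Adj v (b v))
    (hab : ∀ v ∈ D, a v ≠ b v) :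
    2 * #D ≤ k * #(D.image a ∪ D.image b) := by
  set C := D.image a ∪ D.image b with hC
  have h₁ : #D = ∑ w ∈ C, #{v ∈ D | a v = w} :=
    card_eq_sum_card_fiberwise fun v hv => mem_union_left _ (mem_image_of_mem a hv)
  have h₂ : #D = ∑ w ∈ C, #{v ∈ D | b v = w} :=
    card_eq_sum_card_fiberwise fun v hv => mem_union_right _ (mem_image_of_mem b hv)
  have h₃ : ∀ w ∈ C, #{v ∈ D | a v = w} + #{v ∈ D | b v = w} ≤ k := by
    intro w _
    have hdisj : Disjoint {v ∈ D | a v = w} {v ∈ D | b v = w} := by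
      rw [Finset.disjoint_left]
      intro v hv hv'
      simp only [mem_filter] at hv hv'
      exact hab v hv.1 (hv.2.trans hv'.2.symm)
    rw [← card_union_of_disjoint hdisj, ← Set.ncard_coe_finset]
    refine (Set.ncard_le_ncard ?_ (Set.toFinite _)).trans (hdeg w)
    intro v hv
    simp only [coe_union, coe_filter, Set.mem_union, Set.mem_ofPred_eq] at hv
    rw [SimpleGraph.mem_neighborSet]
    rcases hv with ⟨hv, rfl⟩ | ⟨hv, rfl⟩
    exacts [(ha v hv).symm, (hb v hv).symm]
  have h₄ := sum_le_card_nsmul C _ k h₃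
  rw [sum_add_distrib, ← h₁, ← h₂, smul_eq_mul] at h₄
  linarith [mul_comm (#C) k]

/-- A finite graph has an independent dominating set. -/
theorem exists_isIndepSet_dominating {V : Type*} [Finite V] (G : SimpleGraph V) :
    ∃ D : Set V, G.IsIndepSet D ∧ Dominating G D := by
  obtain ⟨D, hD⟩ := Set.Finite.exists_maximal (s := {D : Set V | G.IsIndepSet D})
    (Set.toFinite _) ⟨∅, by simp [SimpleGraph.IsIndepSet]⟩
  refine ⟨D, hD.prop, fun v hv => ?_⟩
  by_contra! h
  refine hv (hD.le_of_ge ?_ (Set.subset_insert v D) (Set.mem_insert v D))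
  refine Set.Pairwise.insert hD.prop fun u hu _ => ⟨fun huv => h u hu huv.symm, h u hu⟩

/-- Every `DD₂`-graph on finitely many vertices has a minimal spanning `DD₂`-subgraph. -/
theorem IsDD2.exists_minimalDD2_le {V : Type*} [Finite V] {G : SimpleGraph V} (hG : IsDD2 G) :
    ∃ H ≤ G, MinimalDD2 H := by
  obtain ⟨H, hHG, hH⟩ := (Set.toFinite {H : SimpleGraph V | IsDD2 H}).exists_le_minimal hG
  exact ⟨H, hHG, hH.prop, fun K hK hK' => hH.not_lt hK' hK⟩

open Finset in
/-- A graph with degrees between `2` and `3` has a spanning `DD₂`-subgraph with at most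
`6n/5` edges. -/
theorem exists_isDD2_le_card_edgeSet_le {V : Type*} [Fintype V] (G : SimpleGraph V)
    (hmin : ∀ v : V, 2 ≤ (G.neighborSet v).ncard) (hmax : ∀ v : V, (G.neighborSet v).ncard ≤ 3) :
    ∃ H ≤ G, IsDD2 H ∧ 5 * H.edgeSet.ncard ≤ 6 * Fintype.card V := by
  classical
  obtain ⟨S, hind, hdom⟩ := exists_isIndepSet_dominating G
  obtain ⟨D, rfl⟩ : ∃ D : Finset V, (D : Set V) = S := ⟨S.toFinset, by simp⟩
  have hpair (v : V) : ∃ x y, G.Adj v x ∧ G.Adj v y ∧ x ≠ y := by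
    obtain ⟨x, hx, y, hy, hxy⟩ := (Set.one_lt_ncard (Set.toFinite _)).1 (hmin v)
    exact ⟨x, y, hx, hy, hxy⟩
  choose a b ha hb hab using hpair
  have hdom' (v : V) : ∃ u, v ∉ D → u ∈ D ∧ G.Adj u v := by
    by_cases hv : v ∈ D
    · exact ⟨v, fun h => absurd hv h⟩
    · obtain ⟨u, hu⟩ := hdom v hv
      exact ⟨u, fun _ => hu⟩
  choose c hc using hdom'
  have hout {v w : V} (hv : v ∈ D) (hvw : G.Adj v w) : w ∉ D :=
    fun hw => hind hv hw hvw.ne hvw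
  set C := D.image a ∪ D.image b with hC
  set U := (D ∪ C)ᶜ with hU
  set E := (D.image fun v => s(v, a v)) ∪ (D.image fun v => s(v, b v)) ∪
    (U.image fun v => s(c v, v)) with hE
  have hEG : (E : Set (Sym2 V)) ⊆ G.edgeSet := by
    intro e he
    simp only [hE, hU, coe_union, coe_image, Set.mem_union, Set.mem_image, mem_coe, mem_compl,
      mem_union, not_or] at he
    rcases he with (⟨v, -, rfl⟩ | ⟨v, -, rfl⟩) | ⟨v, hv, rfl⟩
    exacts [ha v, hb v, (hc v hv.1).2]
  set H := SimpleGraph.fromEdgeSet (E : Set (Sym2 V)) with hH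
  have hadj {x y : V} (h : s(x, y) ∈ E) : H.Adj x y :=
    (SimpleGraph.fromEdgeSet_adj _).2 ⟨h, (hEG h : G.Adj x y).ne⟩
  have hHa {v : V} (hv : v ∈ D) : H.Adj v (a v) :=
    hadj (mem_union_left _ (mem_union_left _ (mem_image_of_mem _ hv)))
  have hHb {v : V} (hv : v ∈ D) : H.Adj v (b v) :=
    hadj (mem_union_left _ (mem_union_right _ (mem_image_of_mem _ hv)))
  have hHc {v : V} (hv : v ∈ U) : H.Adj (c v) v :=
    hadj (mem_union_right _ (mem_image_of_mem _ hv))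
  refine ⟨H, ?_, ⟨D, (D : Set V)ᶜ, disjoint_compl_right, ?_, ?_⟩, ?_⟩
  · intro x y h
    exact hEG ((SimpleGraph.fromEdgeSet_adj _).1 h).1
  · intro v hv
    by_cases hvC : v ∈ C
    · rcases mem_union.1 hvC with h | h <;> obtain ⟨u, hu, rfl⟩ := mem_image.1 h
      exacts [⟨u, hu, hHa hu⟩, ⟨u, hu, hHb hu⟩]
    · refine ⟨c v, (hc v hv).1, hHc ?_⟩
      simpa [hU, hvC] using hv
  · intro v hv
    have hv : v ∈ D := by simpa using hv
    exact ⟨a v, hout hv (ha v), b v, hout hv (hb v), hab v, (hHa hv).symm, (hHb hv).symm⟩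
  · have hedges : H.edgeSet.ncard ≤ #E := by
      rw [← Set.ncard_coe_finset, hH, SimpleGraph.edgeSet_fromEdgeSet]
      exact Set.ncard_le_ncard Set.sdiff_subset (Set.toFinite _)
    have hEcard : #E ≤ #D + #D + #U :=
      (card_union_le _ _).trans (add_le_add ((card_union_le _ _).trans
        (add_le_add card_image_le card_image_le)) card_image_le)
    have hDC : Disjoint D C := by
      rw [Finset.disjoint_right]
      intro w hw
      rcases mem_union.1 hw with h | h <;> obtain ⟨u, hu, rfl⟩ := mem_image.1 h
      exacts [hout hu (ha u), hout hu (hb u)]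
    have hsum : #D + #C + #U = Fintype.card V := by
      rw [← card_union_of_disjoint hDC, card_add_card_compl]
    have hcount : 2 * #D ≤ 3 * #C :=
      two_mul_card_le_mul_card_image_union G hmax D a b (fun v _ => ha v) (fun v _ => hb v)
        fun v _ => hab v
    omega

/-- Every 3-regular graph on `n` vertices has a minimal spanning
`DD₂`-subgraph with at most `6n/5` edges. -/
theorem cubic_exists_minimal_spanning_DD2_small {V : Type} [Fintype V]
    (G : SimpleGraph V) (hreg : ∀ v : V, (G.neighborSet v).ncard = 3) :
    ∃ H : SimpleGraph V, H ≤ G ∧ MinimalDD2 H ∧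
      5 * H.edgeSet.ncard ≤ 6 * Fintype.card V := by
  obtain ⟨K, hKG, hK, hcard⟩ :=
    exists_isDD2_le_card_edgeSet_le G (fun v => by simp [hreg v]) (fun v => (hreg v).le)
  obtain ⟨H, hHK, hH⟩ := hK.exists_minimalDD2_le
  have hle : H.edgeSet.ncard ≤ K.edgeSet.ncard :=
    Set.ncard_le_ncard (SimpleGraph.edgeSet_mono hHK) (Set.toFinite _)
  exact ⟨H, hHK.trans hKG, hH, by omega⟩
end

section
/- Let G be a 3-regular graph on n vertices. Then every minimal spanning DD₂-subgraph H of G satisfies |E(H)| ≤ n. -/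
/-- `A` and its complement witness that `H` is a `DD₂`-graph. -/
def IsDD2Partition {V : Type*} (H : SimpleGraph V) (A : Set V) : Prop :=
  Dominating H A ∧ TwoDominating H Aᶜ

theorem IsDD2.exists_partition {V : Type*} {H : SimpleGraph V} (h : IsDD2 H) :
    ∃ A, IsDD2Partition H A := by
  obtain ⟨D, D2, hdisj, hD, hD2⟩ := h
  refine ⟨D, hD, fun v hv => ?_⟩
  have hv' : v ∈ D := not_not.mp hv
  obtain ⟨u, hu, w, hw, h⟩ := hD2 v (Set.disjoint_left.mp hdisj hv')
  exact ⟨u, Set.disjoint_right.mp hdisj hu, w, Set.disjoint_right.mp hdisj hw, h⟩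

namespace MinimalDD2

variable {V : Type*} {H : SimpleGraph V} {A : Set V}

theorem not_isDD2Partition_deleteEdges (hmin : MinimalDD2 H) {x y : V} (hxy : H.Adj x y)
    (A : Set V) : ¬ IsDD2Partition (H.deleteEdges {s(x, y)}) A := by
  intro h
  refine hmin.2 (H.deleteEdges {s(x, y)}) ?_ ⟨A, Aᶜ, disjoint_compl_right, h.1, h.2⟩
  refine lt_of_le_of_ne (H.deleteEdges_le _) fun heq => ?_
  have h' : (H.deleteEdges {s(x, y)}).Adj x y := by rw [heq]; exact hxy
  simp [SimpleGraph.deleteEdges_adj] at h'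

theorem mem_iff_notMem_of_adj (hmin : MinimalDD2 H) (hA : IsDD2Partition H A) {x y : V}
    (hxy : H.Adj x y) : x ∈ A ↔ y ∉ A := by
  by_contra hne
  have hsame : x ∈ A ↔ y ∈ A := by tauto
  have key : ∀ u v, H.Adj u v → (u ∈ A ↔ v ∉ A) → (H.deleteEdges {s(x, y)}).Adj u v := by
    intro u v huv hside
    rw [SimpleGraph.deleteEdges_adj]
    refine ⟨huv, ?_⟩
    rw [Set.mem_singleton_iff, Sym2.eq_iff]
    rintro (⟨rfl, rfl⟩ | ⟨rfl, rfl⟩) <;> tauto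
  refine hmin.not_isDD2Partition_deleteEdges hxy A ⟨fun v hv => ?_, fun v hv => ?_⟩
  · obtain ⟨u, hu, huv⟩ := hA.1 v hv
    exact ⟨u, hu, key u v huv (by tauto)⟩
  · obtain ⟨u, hu, w, hw, huw, huv, hwv⟩ := hA.2 v hv
    simp only [Set.mem_compl_iff] at hu hw hv
    exact ⟨u, hu, w, hw, huw, key u v huv (by tauto), key w v hwv (by tauto)⟩

/-- A neighbor of a dominating vertex of degree at least three is a leaf. -/
theorem eq_of_adj_of_three_neighbors (hmin : MinimalDD2 H) (hA : IsDD2Partition H A)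
    {a b u w c : V} (ha : a ∈ A) (hab : H.Adj a b) (hau : H.Adj a u) (haw : H.Adj a w)
    (huw : u ≠ w) (hub : u ≠ b) (hwb : w ≠ b) (hbc : H.Adj b c) : c = a := by
  by_contra hca
  have side := fun {x y} => hmin.mem_iff_notMem_of_adj hA (x := x) (y := y)
  have key : ∀ x y, H.Adj x y → x ≠ b → y ≠ b → (H.deleteEdges {s(a, b)}).Adj x y := by
    intro x y hxy hx hy
    rw [SimpleGraph.deleteEdges_adj, Set.mem_singleton_iff, Sym2.eq_iff]
    tauto
  have key' : ∀ x y, H.Adj x y → x ≠ a → y ≠ a → (H.deleteEdges {s(a, b)}).Adj x y := by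
    intro x y hxy hx hy
    rw [SimpleGraph.deleteEdges_adj, Set.mem_singleton_iff, Sym2.eq_iff]
    tauto
  have hb := (side hab).1 ha
  refine hmin.not_isDD2Partition_deleteEdges hab A ⟨fun v hv => ?_, fun v hv => ?_⟩
  · by_cases hvb : v = b
    · subst hvb
      exact ⟨c, (side hbc.symm).2 hb, key' _ _ hbc.symm hca hab.ne'⟩
    · obtain ⟨x, hx, hxv⟩ := hA.1 v hv
      exact ⟨x, hx, key _ _ hxv (by rintro rfl; exact hb hx) hvb⟩
  · by_cases hva : v = a
    · subst hva
      exact ⟨u, (side hau).1 ha, w, (side haw).1 ha, huw,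
        key _ _ hau.symm hub hab.ne, key _ _ haw.symm hwb hab.ne⟩
    · obtain ⟨x, hx, y, hy, hxy, hxv, hyv⟩ := hA.2 v hv
      exact ⟨x, hx, y, hy, hxy, key' _ _ hxv (fun h => hx (h ▸ ha)) hva,
        key' _ _ hyv (fun h => hy (h ▸ ha)) hva⟩

/-- Moving a set `S` of non-leaves into the dominating side and the neighbors of `S` out of it
gives a new partition, provided every other 2-dominating vertex keeps a neighbor. -/
theorem isDD2Partition_exchange (hmin : MinimalDD2 H) (hA : IsDD2Partition H A) {S : Set V}
    (hS : ∀ s ∈ S, s ∉ A) (hdeg : ∀ s ∈ S, ∃ u w, u ≠ w ∧ H.Adj s u ∧ H.Adj s w)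
    (hrest : ∀ v ∉ A, v ∉ S → ∃ a ∈ A, H.Adj a v ∧ ∀ s ∈ S, ¬ H.Adj s a) :
    IsDD2Partition H {v | v ∈ S ∨ v ∈ A ∧ ∀ s ∈ S, ¬ H.Adj s v} := by
  have side := fun {x y} => hmin.mem_iff_notMem_of_adj hA (x := x) (y := y)
  have out : ∀ s ∈ S, ∀ u, H.Adj s u → ¬ (u ∈ S ∨ u ∈ A ∧ ∀ s ∈ S, ¬ H.Adj s u) := by
    rintro s hs u hsu (hu | hu)
    · exact hS u hu ((side hsu.symm).2 (hS s hs))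
    · exact hu.2 s hs hsu
  constructor
  · intro v hv
    simp only [Set.mem_ofPred_eq, not_or, not_and, not_forall, not_not] at hv
    by_cases hvA : v ∈ A
    · obtain ⟨s, hs, hsv⟩ := hv.2 hvA
      exact ⟨s, Or.inl hs, hsv⟩
    · obtain ⟨a, ha, hav, h⟩ := hrest v hvA hv.1
      exact ⟨a, Or.inr ⟨ha, h⟩, hav⟩
  · intro v hv
    rcases not_not.mp hv with hvS | ⟨hvA, hvn⟩
    · obtain ⟨u, w, huw, hu, hw⟩ := hdeg v hvS
      exact ⟨u, out v hvS u hu, w, out v hvS w hw, huw, hu.symm, hw.symm⟩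
    · have out' : ∀ u, u ∉ A → H.Adj u v → ¬ (u ∈ S ∨ u ∈ A ∧ ∀ s ∈ S, ¬ H.Adj s u) := by
        rintro u hu huv (h | h)
        · exact hvn u h huv
        · exact hu h.1
      obtain ⟨u, hu, w, hw, huw, huv, hwv⟩ := hA.2 v (fun h => h hvA)
      exact ⟨u, out' u hu huv, w, out' w hw hwv, huw, huv, hwv⟩

/-- A 2-dominating vertex of degree at least three has a leaf at distance two, the middle
vertex having no further neighbor. -/
theorem exists_leaf_of_three_neighbors (hmin : MinimalDD2 H) (hA : IsDD2Partition H A)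
    {b a₁ a₂ a₃ : V} (hb : b ∉ A) (h₁ : H.Adj b a₁) (h₂ : H.Adj b a₂) (h₃ : H.Adj b a₃)
    (h₁₂ : a₁ ≠ a₂) (h₁₃ : a₁ ≠ a₃) (h₂₃ : a₂ ≠ a₃) :
    ∃ a l, H.Adj b a ∧ H.Adj a l ∧ l ≠ b ∧ (∀ c, H.Adj l c → c = a) ∧
      ∀ c, H.Adj a c → c = b ∨ c = l := by
  have side := fun {x y} => hmin.mem_iff_notMem_of_adj hA (x := x) (y := y)
  have nbrs : ∀ a w, H.Adj b a → H.Adj w a → w ≠ b → ∀ c, H.Adj a c → c = b ∨ c = w := by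
    intro a w hba hwa hwb c hac
    by_contra! hc
    have leaf : ∀ x, H.Adj b x → x = a := fun x hx =>
      hmin.eq_of_adj_of_three_neighbors hA ((side hba.symm).2 hb) hba.symm hwa.symm hac
        hc.2.symm hwb hc.1 hx
    exact h₁₂ ((leaf _ h₁).trans (leaf _ h₂).symm)
  obtain ⟨w, hwA, hwb, hw⟩ : ∃ w ∉ A, w ≠ b ∧ ∀ a, H.Adj w a → H.Adj b a := by
    by_contra! hcon
    have hA' := hmin.isDD2Partition_exchange hA (S := {b}) (by simpa using hb)
      (by simpa using ⟨a₁, a₂, h₁₂, h₁, h₂⟩) (by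
        intro v hv hvb
        obtain ⟨a, hva, hba⟩ := hcon v hv hvb
        exact ⟨a, (side hva.symm).2 hv, hva.symm, by simpa using hba⟩)
    have ha₁ : a₁ ∈ A := (side h₁.symm).2 hb
    obtain ⟨u, huA, hub, hu⟩ : ∃ u ∉ A, u ≠ b ∧ H.Adj u a₁ := by
      obtain ⟨x, hx, y, hy, hxy, hxv, hyv⟩ := hA.2 a₁ (fun h => h ha₁)
      by_cases hxb : x = b
      · exact ⟨y, hy, fun h => hxy (hxb.trans h.symm), hyv⟩
      · exact ⟨x, hx, hxb, hxv⟩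
    have := hmin.mem_iff_notMem_of_adj hA' hu
    simp only [Set.mem_ofPred_eq, Set.mem_singleton_iff] at this
    simp [hub, huA, h₁, h₁.ne'] at this
  obtain ⟨a, haA, haw⟩ := hA.1 w hwA
  have hba := hw a haw.symm
  refine ⟨a, w, hba, haw, hwb, ?_, nbrs a w hba haw.symm hwb⟩
  by_contra! hleaf
  obtain ⟨a', hwa', ha'a⟩ := hleaf
  have hrest : ∀ v ∉ A, v ≠ w → v ≠ b → ∃ x ∈ A, H.Adj x v ∧ ¬ H.Adj w x := by
    intro v hv hvw hvb
    obtain ⟨x, hx, hxv⟩ := hA.1 v hv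
    refine ⟨x, hx, hxv, fun hwx => ?_⟩
    rcases nbrs x w (hw x hwx) hwx hwb v hxv with h | h
    · exact hvb h
    · exact hvw h
  by_cases hc : ∃ c, H.Adj b c ∧ ¬ H.Adj w c
  · obtain ⟨c, hbc, hwc⟩ := hc
    have hA' := hmin.isDD2Partition_exchange hA (S := {w}) (by simpa using hwA)
      (by simpa using ⟨a, a', ha'a.symm, haw.symm, hwa'⟩) (by
        intro v hv hvw
        by_cases hvb : v = b
        · subst hvb
          exact ⟨c, (side hbc.symm).2 hb, hbc.symm, by simpa using hwc⟩
        · simpa using hrest v hv hvw hvb)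
    have := hmin.mem_iff_notMem_of_adj hA' hba
    simp only [Set.mem_ofPred_eq, Set.mem_singleton_iff] at this
    simp [hwb.symm, hb, haw.symm, haw.ne] at this
  · push Not at hc
    have hA' := hmin.isDD2Partition_exchange hA (S := {b, w}) (by simp [hb, hwA])
      (by
        rintro s (rfl | rfl)
        · exact ⟨a₁, a₂, h₁₂, h₁, h₂⟩
        · exact ⟨a, a', ha'a.symm, haw.symm, hwa'⟩) (by
        intro v hv hvS
        simp only [Set.mem_insert_iff, Set.mem_singleton_iff, not_or] at hvS
        obtain ⟨x, hx, hxv, hwx⟩ := hrest v hv hvS.2 hvS.1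
        refine ⟨x, hx, hxv, ?_⟩
        rintro s (rfl | rfl)
        · exact fun h => hwx (hc x h)
        · exact hwx)
    exact hwb (hmin.eq_of_adj_of_three_neighbors hA' (Or.inl (Or.inl rfl)) h₁ h₂ h₃ h₂₃
      h₁₂.symm h₁₃.symm (hc a₁ h₁).symm)

/-- In a minimal `DD₂`-graph there are at most as many vertices of degree three as leaves. -/
theorem card_degree_three_le_card_degree_one [Fintype V] [DecidableRel H.Adj]
    (hmin : MinimalDD2 H) :
    (Finset.univ.filter fun v => H.degree v = 3).card ≤
      (Finset.univ.filter fun v => H.degree v = 1).card := by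
  classical
  obtain ⟨A, hA⟩ := hmin.1.exists_partition
  have charge : ∀ v, H.degree v = 3 → ∃ l a, H.Adj l a ∧ (∀ c, H.Adj l c → c = a) ∧
      (v = a ∨ v ≠ l ∧ H.Adj a v ∧ ∀ c, H.Adj a c → c = v ∨ c = l) := by
    intro v hv
    obtain ⟨x, y, z, hxy, hxz, hyz, hN⟩ := Finset.card_eq_three.mp hv
    have hx : H.Adj v x := by rw [← SimpleGraph.mem_neighborFinset, hN]; simp
    have hy : H.Adj v y := by rw [← SimpleGraph.mem_neighborFinset, hN]; simp
    have hz : H.Adj v z := by rw [← SimpleGraph.mem_neighborFinset, hN]; simp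
    by_cases hvA : v ∈ A
    · exact ⟨x, v, hx.symm, fun c hc => hmin.eq_of_adj_of_three_neighbors hA hvA hx hy hz
        hyz hxy.symm hxz.symm hc, Or.inl rfl⟩
    · obtain ⟨a, l, hva, hal, hlv, hl, ha⟩ :=
        hmin.exists_leaf_of_three_neighbors hA hvA hx hy hz hxy hxz hyz
      exact ⟨l, a, hal.symm, hl, Or.inr ⟨hlv.symm, hva.symm, ha⟩⟩
  have degree_ne : ∀ a v l, H.degree a = 3 → ¬ ∀ c, H.Adj a c → c = v ∨ c = l := by
    intro a v l ha h
    have hsub : H.neighborFinset a ⊆ {v, l} := fun c hc => by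
      simpa using h c (by simpa using hc)
    have := (Finset.card_le_card hsub).trans Finset.card_le_two
    rw [SimpleGraph.card_neighborFinset_eq_degree] at this
    omega
  choose! f g hadj hleaf hfg using charge
  refine Finset.card_le_card_of_injOn f (fun v hv => ?_) fun v hv v' hv' hff => ?_
  · have hv : H.degree v = 3 := by simpa using hv
    have : H.degree (f v) = 1 := Finset.card_eq_one.mpr ⟨g v, by
      ext c
      rw [SimpleGraph.mem_neighborFinset, Finset.mem_singleton]
      exact ⟨hleaf v hv c, fun h => h ▸ hadj v hv⟩⟩
    simpa using this
  · have hv : H.degree v = 3 := by simpa using hv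
    have hv' : H.degree v' = 3 := by simpa using hv'
    have hgg : g v = g v' := hleaf v' hv' _ (hff ▸ hadj v hv)
    rcases hfg v hv with h | ⟨hne, hav, h⟩ <;> rcases hfg v' hv' with h' | ⟨hne', hav', h'⟩
    · rw [h, h', hgg]
    · rw [← hgg, ← h] at h'
      exact absurd h' (degree_ne v _ _ hv)
    · rw [hgg, ← h'] at h
      exact absurd h (degree_ne v' _ _ hv')
    · rcases h' v (hgg ▸ hav) with h'' | h''
      · exact h''
      · exact absurd (h''.trans hff.symm) hne

theorem degree_pos [Fintype V] [DecidableRel H.Adj] (hmin : MinimalDD2 H) (v : V) :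
    0 < H.degree v := by
  obtain ⟨A, hA⟩ := hmin.1.exists_partition
  rw [SimpleGraph.degree_pos_iff_exists_adj]
  by_cases hv : v ∈ A
  · obtain ⟨u, -, -, -, -, huv, -⟩ := hA.2 v (fun h => h hv)
    exact ⟨u, huv.symm⟩
  · obtain ⟨u, -, huv⟩ := hA.1 v hv
    exact ⟨u, huv.symm⟩

theorem card_edgeFinset_le_card [Fintype V] [DecidableEq V] [DecidableRel H.Adj]
    (hmin : MinimalDD2 H) (hdeg : ∀ v, H.degree v ≤ 3) :
    H.edgeFinset.card ≤ Fintype.card V := by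
  have hpoint : ∀ v, H.degree v + (if H.degree v = 1 then 1 else 0) =
      2 + (if H.degree v = 3 then 1 else 0) := by
    intro v
    have h1 := hmin.degree_pos v
    have h2 := hdeg v
    split_ifs <;> omega
  have hsum := Finset.sum_congr (rfl : (Finset.univ : Finset V) = _) fun v _ => hpoint v
  rw [Finset.sum_add_distrib, Finset.sum_add_distrib, ← Finset.card_filter,
    ← Finset.card_filter, H.sum_degrees_eq_twice_card_edges, Finset.sum_const,
    Finset.card_univ, smul_eq_mul] at hsum
  have := hmin.card_degree_three_le_card_degree_one
  omega

end MinimalDD2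

/-- In a 3-regular graph on `n` vertices, every minimal spanning
`DD₂`-subgraph has at most `n` edges. -/
theorem cubic_minimal_spanning_DD2_edge_le_card {V : Type} [Fintype V]
    (G H : SimpleGraph V) (hreg : ∀ v : V, (G.neighborSet v).ncard = 3)
    (hle : H ≤ G) (hmin : MinimalDD2 H) :
    H.edgeSet.ncard ≤ Fintype.card V := by
  classical
  rw [← SimpleGraph.coe_edgeFinset, Set.ncard_coe_finset]
  refine hmin.card_edgeFinset_le_card fun v => ?_
  rw [← hreg v, ← SimpleGraph.card_neighborFinset_eq_degree, ← Set.ncard_coe_finset,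
    SimpleGraph.coe_neighborFinset]
  exact Set.ncard_le_ncard (fun w hw => hle hw) (Set.toFinite _)
end

section
/- Let G be a 3-regular graph. For any two minimal spanning DD₂-subgraphs H and H' of G, |E(H)| ≤ 1.5 · |E(H')|. In particular, a maximum-size minimal spanning DD₂-subgraph has at most 1.5 times as many edges as any minimal spanning DD₂-subgraph. -/
/-- `B` is 2-dominating and its complement is dominating, phrased side by side. -/
def IsDD2Split {V : Type*} (G : SimpleGraph V) (B : Set V) : Prop :=
  (∀ v ∉ B, ∃ u ∈ B, ∃ w ∈ B, u ≠ w ∧ G.Adj v u ∧ G.Adj v w) ∧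
    ∀ v ∈ B, ∃ u ∉ B, G.Adj v u

theorem IsDD2.exists_split {V : Type*} {G : SimpleGraph V} (h : IsDD2 G) :
    ∃ B, IsDD2Split G B := by
  obtain ⟨D, D2, hdisj, hD, hD2⟩ := h
  refine ⟨D2, fun v hv => ?_, fun v hv => ?_⟩
  · obtain ⟨u, hu, w, hw, hne, huv, hwv⟩ := hD2 v hv
    exact ⟨u, hu, w, hw, hne, huv.symm, hwv.symm⟩
  · obtain ⟨u, hu, huv⟩ := hD v (Set.disjoint_right.mp hdisj hv)
    exact ⟨u, Set.disjoint_left.mp hdisj hu, huv.symm⟩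

theorem IsDD2Split.isDD2 {V : Type*} {G : SimpleGraph V} {B : Set V} (h : IsDD2Split G B) :
    IsDD2 G := by
  refine ⟨Bᶜ, B, disjoint_compl_left, fun v hv => ?_, fun v hv => ?_⟩
  · obtain ⟨u, hu, huv⟩ := h.2 v (not_not.mp hv)
    exact ⟨u, hu, huv.symm⟩
  · obtain ⟨u, hu, w, hw, hne, huv, hwv⟩ := h.1 v hv
    exact ⟨u, hu, w, hw, hne, huv.symm, hwv.symm⟩

theorem MinimalDD2.not_split_deleteEdges {V : Type*} {H : SimpleGraph V} (hH : MinimalDD2 H)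
    {x y : V} (hxy : H.Adj x y) (B : Set V) :
    ¬ IsDD2Split (H.deleteEdges {s(x, y)}) B := by
  refine fun h => hH.2 _ (lt_of_le_of_ne (H.deleteEdges_le _) fun he => ?_) h.isDD2
  have : (H.deleteEdges {s(x, y)}).Adj x y := by rwa [he]
  simp at this

/-- In a minimal `DD₂`-graph every edge joins the two sides of every split. -/
theorem MinimalDD2.mem_iff_notMem {V : Type*} {H : SimpleGraph V} (hH : MinimalDD2 H)
    {B : Set V} (hB : IsDD2Split H B) {x y : V} (hxy : H.Adj x y) : x ∈ B ↔ y ∉ B := by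
  by_contra hcon
  refine hH.not_split_deleteEdges hxy B ⟨fun v hv => ?_, fun v hv => ?_⟩
  · obtain ⟨u, hu, w, hw, hne, huv, hwv⟩ := hB.1 v hv
    refine ⟨u, hu, w, hw, hne, ?_, ?_⟩ <;>
    · simp only [SimpleGraph.deleteEdges_adj, Set.mem_singleton_iff, Sym2.eq_iff]
      grind
  · obtain ⟨u, hu, huv⟩ := hB.2 v hv
    refine ⟨u, hu, ?_⟩
    simp only [SimpleGraph.deleteEdges_adj, Set.mem_singleton_iff, Sym2.eq_iff]
    grind

/-- In a minimal `DD₂`-graph, an edge from a vertex of degree at least three on the dominating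
side leads to a leaf. -/
theorem MinimalDD2.eq_of_adj {V : Type*} {H : SimpleGraph V} (hH : MinimalDD2 H)
    {B : Set V} (hB : IsDD2Split H B) {a b : V} (ha : a ∉ B) (hab : H.Adj a b)
    (h3 : ∃ x y, x ≠ y ∧ x ≠ b ∧ y ≠ b ∧ H.Adj a x ∧ H.Adj a y) {a' : V} (ha' : H.Adj a' b) :
    a' = a := by
  by_contra hne'
  obtain ⟨x, y, hxy, hxb, hyb, hax, hay⟩ := h3
  have side : ∀ {x y}, H.Adj x y → (x ∈ B ↔ y ∉ B) := fun h => hH.mem_iff_notMem hB h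
  refine hH.not_split_deleteEdges hab B ⟨fun v hv => ?_, fun v hv => ?_⟩
  · by_cases hva : v = a
    · subst hva
      refine ⟨x, by grind, y, by grind, hxy, ?_, ?_⟩ <;>
      · simp only [SimpleGraph.deleteEdges_adj, Set.mem_singleton_iff, Sym2.eq_iff]
        grind
    · obtain ⟨u, hu, w, hw, hne, huv, hwv⟩ := hB.1 v hv
      refine ⟨u, hu, w, hw, hne, ?_, ?_⟩ <;>
      · simp only [SimpleGraph.deleteEdges_adj, Set.mem_singleton_iff, Sym2.eq_iff]
        grind
  · by_cases hvb : v = b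
    · subst hvb
      refine ⟨a', by grind, ?_⟩
      simp only [SimpleGraph.deleteEdges_adj, Set.mem_singleton_iff, Sym2.eq_iff]
      grind [SimpleGraph.adj_comm]
    · obtain ⟨u, hu, huv⟩ := hB.2 v hv
      refine ⟨u, hu, ?_⟩
      simp only [SimpleGraph.deleteEdges_adj, Set.mem_singleton_iff, Sym2.eq_iff]
      grind

/-- Exchanging the neighbourhood of `b` with the vertices whose neighbourhood it contains turns a
split into another one, provided that none of these vertices is a leaf. -/
theorem MinimalDD2.exchange {V : Type*} {H : SimpleGraph V} (hH : MinimalDD2 H)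
    {B : Set V} (hB : IsDD2Split H B) {b : V}
    (hleaf : ∀ c ∈ B, (∀ u, H.Adj c u → H.Adj b u) → ∃ u w, u ≠ w ∧ H.Adj c u ∧ H.Adj c w) :
    IsDD2Split H {v | H.Adj b v ∨ (v ∈ B ∧ ∃ u, H.Adj v u ∧ ¬ H.Adj b u)} := by
  have side : ∀ {x y}, H.Adj x y → (x ∈ B ↔ y ∉ B) := fun h => hH.mem_iff_notMem hB h
  refine ⟨fun v hv => ?_, fun v hv => ?_⟩
  · simp only [Set.mem_ofPred_eq, not_or, not_and, not_exists, not_not] at hv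
    by_cases hvB : v ∈ B
    · obtain ⟨u, w, hne, hu, hw⟩ := hleaf v hvB (hv.2 hvB)
      exact ⟨u, Or.inl (hv.2 hvB u hu), w, Or.inl (hv.2 hvB w hw), hne, hu, hw⟩
    · obtain ⟨u, hu, w, hw, hne, huv, hwv⟩ := hB.1 v hvB
      exact ⟨u, Or.inr ⟨hu, v, huv.symm, hv.1⟩, w, Or.inr ⟨hw, v, hwv.symm, hv.1⟩, hne, huv, hwv⟩
  · by_cases hbv : H.Adj b v
    · refine ⟨b, ?_, hbv.symm⟩
      simp
    · obtain ⟨hvB, u, hvu, hbu⟩ := hv.resolve_left hbv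
      refine ⟨u, ?_, hvu⟩
      have := side hvu
      simp only [Set.mem_ofPred_eq]
      tauto

section Degree

open Classical

variable {V : Type*} [Fintype V]

/-- In a minimal `DD₂`-graph, a vertex of degree at least three is adjacent to a leaf, or has a
neighbour of degree two whose other neighbour is a leaf. -/
theorem MinimalDD2.exists_leaf {H : SimpleGraph V} (hH : MinimalDD2 H) {v : V}
    (hv : 2 < H.degree v) :
    ∃ c a, H.degree c = 1 ∧ H.Adj c a ∧ (a = v ∨ (v ≠ c ∧ H.Adj v a ∧ H.degree a = 2)) := by
  obtain ⟨B, hB⟩ := hH.1.exists_split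
  obtain ⟨x, hx, y, hy, z, hz, hxy, hxz, hyz⟩ := Finset.two_lt_card.mp hv
  rw [SimpleGraph.mem_neighborFinset] at hx hy hz
  have side : ∀ {x y}, H.Adj x y → (x ∈ B ↔ y ∉ B) := fun h => hH.mem_iff_notMem hB h
  by_cases hvB : v ∈ B
  · have deg_two : ∀ a, H.Adj v a → H.degree a = 2 := by
      intro a hva
      have haB := (side hva).mp hvB
      refine le_antisymm (not_lt.mp fun hlt => ?_) ?_
      · have : ∃ p q, p ≠ q ∧ p ≠ v ∧ q ≠ v ∧ H.Adj a p ∧ H.Adj a q := by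
          obtain ⟨p, hp, q, hq, r, hr, hpq, hpr, hqr⟩ := Finset.two_lt_card.mp hlt
          rw [SimpleGraph.mem_neighborFinset] at hp hq hr
          grind
        have key := fun u (hu : H.Adj v u) => hH.eq_of_adj hB haB hva.symm this hu.symm
        exact hxy ((key x hx).trans (key y hy).symm)
      · obtain ⟨u, -, w, -, hne, hu, hw⟩ := hB.1 a haB
        exact Finset.one_lt_card.mpr ⟨u, by simpa using hu, w, by simpa using hw, hne⟩
    by_contra! hcon
    have hex := hH.exchange hB (by
      intro c hc hsub
      obtain ⟨a, -, hca⟩ := hB.2 c hc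
      have hva := hsub a hca
      by_cases hcv : c = v
      · subst hcv
        exact ⟨x, y, hxy, hx, hy⟩
      have h1 : H.degree c ≠ 1 := fun h1 =>
        (hcon c a h1 hca).2 (Ne.symm hcv) hva (deg_two a hva)
      have h0 : 0 < H.degree c := (H.degree_pos_iff_exists_adj c).mpr ⟨a, hca⟩
      obtain ⟨p, hp, q, hq, hpq⟩ := Finset.one_lt_card.mp (show 1 < H.degree c by omega)
      exact ⟨p, q, hpq, by simpa using hp, by simpa using hq⟩)
    have hvC : v ∉ {w | H.Adj v w ∨ (w ∈ B ∧ ∃ u, H.Adj w u ∧ ¬ H.Adj v u)} := by simp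
    obtain ⟨p, hp, q, hq, hpq⟩ := Finset.one_lt_card.mp
      (show 1 < H.degree x by rw [deg_two x hx]; norm_num)
    rw [SimpleGraph.mem_neighborFinset] at hp hq
    obtain ⟨w, hwv, hw⟩ : ∃ w, w ≠ v ∧ H.Adj w x := by
      by_cases hpv : p = v
      · exact ⟨q, by grind, hq.symm⟩
      · exact ⟨p, hpv, hp.symm⟩
    exact hwv (hH.eq_of_adj hex hvC hx ⟨y, z, hyz, hxy.symm, hxz.symm, hy, hz⟩ hw)
  · refine ⟨x, v, ?_, hx.symm, Or.inl rfl⟩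
    exact SimpleGraph.degree_eq_one_iff_existsUnique_adj.mpr ⟨v, hx.symm, fun u hu =>
      hH.eq_of_adj hB hvB hx ⟨y, z, hyz, hxy.symm, hxz.symm, hy, hz⟩ hu.symm⟩

theorem MinimalDD2.card_edgeFinset_le {H : SimpleGraph V} (hH : MinimalDD2 H)
    (hdeg : ∀ v, H.degree v ≤ 3) : H.edgeFinset.card ≤ Fintype.card V := by
  have hinj : (Finset.univ.filter fun v => 2 < H.degree v).card ≤
      (Finset.univ.filter fun v => H.degree v = 1).card := by
    choose! c a hc hca ha using fun v (hv : 2 < H.degree v) => hH.exists_leaf hv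
    refine Finset.card_le_card_of_injOn c (fun v hv => ?_) fun v hv w hw hvw => ?_
    · simpa using hc v (by simpa using hv)
    · have hv : 2 < H.degree v := by simpa using hv
      have hw : 2 < H.degree w := by simpa using hw
      have haa : a v = a w :=
        (SimpleGraph.degree_eq_one_iff_existsUnique_adj.mp (hc v hv)).unique (hca v hv)
          (hvw ▸ hca w hw)
      rcases ha v hv with h1 | ⟨h1, h1', h1''⟩ <;> rcases ha w hw with h2 | ⟨h2, h2', h2''⟩
      · rw [← h1, haa, h2]
      · rw [← haa, h1] at h2''
        omega
      · rw [haa, h2] at h1''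
        omega
      · by_contra hne
        have : 2 < H.degree (a v) := Finset.two_lt_card.mpr
          ⟨c v, by simpa using (hca v hv).symm, v, by simpa using h1'.symm, w,
            by simpa [haa] using h2'.symm, h1.symm, by rw [hvw]; exact h2.symm, hne⟩
        omega
  have hsum : ∑ v, (H.degree v + if H.degree v = 1 then 1 else 0) ≤
      ∑ v : V, (2 + if 2 < H.degree v then 1 else 0) := by
    refine Finset.sum_le_sum fun v _ => ?_
    have := hdeg v
    split_ifs <;> omega
  rw [Finset.sum_add_distrib, Finset.sum_add_distrib, H.sum_degrees_eq_twice_card_edges,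
    ← Finset.card_filter, ← Finset.card_filter, Finset.sum_const, Finset.card_univ,
    smul_eq_mul] at hsum
  omega

theorem IsDD2.two_mul_card_le {H : SimpleGraph V} (hH : IsDD2 H) :
    2 * Fintype.card V ≤ 3 * H.edgeFinset.card := by
  obtain ⟨B, hB⟩ := hH.exists_split
  set S : Finset V := Finset.univ.filter (· ∈ B)
  have hS : ∀ v, v ∈ S ↔ v ∈ B := by simp [S]
  set K := H.between S ↑Sᶜ
  have hK : K.IsBipartiteWith S ↑Sᶜ := SimpleGraph.between_isBipartiteWith (by
    simpa using disjoint_compl_right)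
  have hadj : ∀ v w, K.Adj v w ↔ H.Adj v w ∧ (v ∈ B ↔ w ∉ B) := by
    intro v w
    rw [SimpleGraph.between_adj]
    simp only [Finset.mem_coe, Finset.mem_compl, hS]
    tauto
  have h1 : S.card • 1 ≤ ∑ v ∈ S, K.degree v := by
    refine Finset.card_nsmul_le_sum _ _ _ fun v hv => ?_
    obtain ⟨u, hu, hvu⟩ := hB.2 v ((hS v).mp hv)
    exact (K.degree_pos_iff_exists_adj v).mpr
      ⟨u, (hadj v u).mpr ⟨hvu, by simp [hu, (hS v).mp hv]⟩⟩
  have h2 : Sᶜ.card • 2 ≤ ∑ v ∈ Sᶜ, K.degree v := by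
    refine Finset.card_nsmul_le_sum _ _ _ fun v hv => ?_
    rw [Finset.mem_compl, hS] at hv
    obtain ⟨u, hu, w, hw, hne, hvu, hvw⟩ := hB.1 v hv
    refine Finset.one_lt_card.mpr ⟨u, ?_, w, ?_, hne⟩ <;>
    · rw [SimpleGraph.mem_neighborFinset, hadj]
      tauto
  rw [SimpleGraph.isBipartiteWith_sum_degrees_eq_card_edges hK, smul_eq_mul] at h1
  rw [SimpleGraph.isBipartiteWith_sum_degrees_eq_card_edges hK.symm, smul_eq_mul] at h2
  have h3 : K.edgeFinset.card ≤ H.edgeFinset.card :=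
    Finset.card_le_card (SimpleGraph.edgeFinset_mono H.between_le)
  have h4 := S.card_add_card_compl
  omega

end Degree

/-- In a 3-regular graph, any two minimal spanning `DD₂`-subgraphs `H`
and `H'` satisfy `|E(H)| ≤ 1.5 |E(H')|`. -/
theorem cubic_max_DD2_approx_1_5 {V : Type} [Fintype V]
    (G H H' : SimpleGraph V) (hreg : ∀ v : V, (G.neighborSet v).ncard = 3)
    (hHle : H ≤ G) (hHmin : MinimalDD2 H)
    (hH'le : H' ≤ G) (hH'min : MinimalDD2 H') :
    (H.edgeSet.ncard : ℝ) ≤ 1.5 * (H'.edgeSet.ncard : ℝ) := by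
  classical
  have hdeg : ∀ v, H.degree v ≤ 3 := by
    intro v
    rw [← hreg v, ← SimpleGraph.card_neighborSet_eq_degree, ← Nat.card_eq_fintype_card,
      Nat.card_coe_set_eq]
    exact Set.ncard_le_ncard fun w hw => hHle hw
  have h1 := hHmin.card_edgeFinset_le hdeg
  have h2 := hH'min.1.two_mul_card_le
  rw [← SimpleGraph.coe_edgeFinset, ← SimpleGraph.coe_edgeFinset, Set.ncard_coe_finset,
    Set.ncard_coe_finset]
  have h3 : (2 * H.edgeFinset.card : ℝ) ≤ 3 * H'.edgeFinset.card := by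
    exact_mod_cast (by convert (Nat.mul_le_mul_left 2 h1).trans h2)
  linarith
end

section
/- Let G be a 3-regular graph and let H be a connected subgraph of G such that V(H) is partitioned into independent sets A and B, every vertex a ∈ A has degree exactly 2 in H, and every vertex b ∈ B is a leaf of H or is at distance two in H from some leaf of H. Then H does not contain two distinct cycles; consequently |E(H)| ≤ |V(H)|. -/
/-- In a connected graph with at most as many edges as vertices, any edge of a cycle lies on every
cycle. -/
theorem SimpleGraph.Connected.mem_edges_of_card_edgeSet_le {W : Type*} [Finite W]
    {K : SimpleGraph W} (hK : K.Connected) (hcard : Nat.card K.edgeSet ≤ Nat.card W)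
    {v w : W} {p : K.Walk v v} {q : K.Walk w w} (hp : p.IsCycle) (hq : q.IsCycle)
    {e : Sym2 W} (he : e ∈ p.edges) : e ∈ q.edges := by
  by_contra heq
  have delete : ∀ {K : SimpleGraph W} {u : W} {c : K.Walk u u} {e : Sym2 W}, K.Connected →
      c.IsCycle → e ∈ c.edges → (K.deleteEdges {e}).Connected ∧
        Nat.card (K.deleteEdges {e}).edgeSet + 1 = Nat.card K.edgeSet := by
    intro K u c e hK hc he
    have heK := c.edges_subset_edgeSet he
    constructor
    · have hbr : ¬ K.IsBridge e := fun hb ↦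
        (SimpleGraph.isBridge_iff_forall_cycle_notMem heK).1 hb c hc he
      induction e with
      | _ x y => exact hK.connected_delete_edge_of_not_isBridge hbr
    · rw [SimpleGraph.edgeSet_deleteEdges, Nat.card_coe_set_eq, Nat.card_coe_set_eq]
      exact Set.ncard_sdiff_singleton_add_one heK
  obtain ⟨h₁, hc₁⟩ := delete hK hp he
  have hq' := hq.toDeleteEdges K {e} fun f hf hfe ↦
    heq (Set.mem_singleton_iff.1 hfe ▸ hf)
  obtain ⟨f, hf⟩ := List.exists_mem_of_ne_nil _
    (fun h ↦ hq'.not_nil (SimpleGraph.Walk.edges_eq_nil.1 h))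
  obtain ⟨h₂, hc₂⟩ := delete h₁ hq' hf
  have := h₂.card_vert_le_card_edgeSet_add_one
  omega

/-- If, in a bipartite subgraph, the vertices of one side `A` have degree two and each vertex of
the other side `B` has degree at most three and is a leaf or at distance two from a leaf, then
there are at most as many edges as vertices. -/
theorem SimpleGraph.Subgraph.ncard_edgeSet_le_ncard_verts {V : Type*} [Finite V]
    {G : SimpleGraph V} {H : G.Subgraph} {A B : Set V} (hdisj : Disjoint A B)
    (hcover : A ∪ B = H.verts)
    (hAind : ∀ u ∈ A, ∀ v ∈ A, ¬ H.Adj u v) (hBind : ∀ u ∈ B, ∀ v ∈ B, ¬ H.Adj u v)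
    (hdegA : ∀ a ∈ A, (H.neighborSet a).ncard = 2)
    (hdegB : ∀ b ∈ B, (H.neighborSet b).ncard ≤ 3)
    (hB : ∀ b ∈ B, (H.neighborSet b).ncard = 1 ∨
      ∃ l : V, (H.neighborSet l).ncard = 1 ∧ b ≠ l ∧ ∃ x : V, H.Adj b x ∧ H.Adj x l) :
    H.edgeSet.ncard ≤ H.verts.ncard := by
  classical
  have := Fintype.ofFinite V
  have memA : ∀ {u v}, u ∈ B → H.Adj u v → v ∈ A := fun hu h ↦
    (hcover.symm ▸ h.snd_mem : _ ∈ A ∪ B).resolve_right fun hv ↦ hBind _ hu _ hv h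
  have memB : ∀ {u v}, u ∈ A → H.Adj u v → v ∈ B := fun hu h ↦
    (hcover.symm ▸ h.snd_mem : _ ∈ A ∪ B).resolve_left fun hv ↦ hAind _ hu _ hv h
  have hbip : H.spanningCoe.IsBipartiteWith (A.toFinset : Set V) (B.toFinset : Set V) := by
    refine ⟨by simpa using hdisj, fun v w h ↦ ?_⟩
    simp only [Set.coe_toFinset]
    have h' : H.Adj v w := h
    rcases (hcover.symm ▸ h'.fst_mem : v ∈ A ∪ B) with hv | hv
    · exact .inl ⟨hv, memB hv h'⟩
    · exact .inr ⟨hv, memA hv h'⟩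
  have hdeg (v : V) : H.spanningCoe.degree v = (H.neighborSet v).ncard := by
    rw [← SimpleGraph.card_neighborFinset_eq_degree, ← Set.ncard_coe_finset]
    congr 1
    ext w
    simp
  have hE : H.spanningCoe.edgeFinset.card = H.edgeSet.ncard := by
    rw [← Set.ncard_coe_finset, SimpleGraph.coe_edgeFinset, SimpleGraph.Subgraph.edgeSet_spanningCoe]
  have hsumA := SimpleGraph.isBipartiteWith_sum_degrees_eq_card_edges hbip
  have hsumB := SimpleGraph.isBipartiteWith_sum_degrees_eq_card_edges' hbip
  simp only [hdeg, hE] at hsumA hsumB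
  rw [Finset.sum_congr rfl (fun a ha ↦ hdegA a (Set.mem_toFinset.1 ha)), Finset.sum_const,
    smul_eq_mul] at hsumA
  set L := B.toFinset.filter fun b ↦ (H.neighborSet b).ncard = 1 with hL
  set N := B.toFinset.filter fun b ↦ ¬ (H.neighborSet b).ncard = 1 with hN
  have hNL : N.card ≤ L.card := by
    have hex : ∀ b ∈ N, ∃ l ∈ L, b ≠ l ∧ ∃ x : V, H.Adj b x ∧ H.Adj x l := by
      intro b hb
      simp only [hN, Finset.mem_filter, Set.mem_toFinset] at hb
      obtain ⟨l, hl, hne, x, hbx, hxl⟩ := (hB b hb.1).resolve_left hb.2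
      refine ⟨l, ?_, hne, x, hbx, hxl⟩
      exact Finset.mem_filter.2 ⟨Set.mem_toFinset.2 (memB (memA hb.1 hbx) hxl), hl⟩
    refine Finset.card_le_card_of_forall_subsingleton
      (fun b l ↦ b ≠ l ∧ ∃ x : V, H.Adj b x ∧ H.Adj x l) hex ?_
    rintro l hl b ⟨hb, hbl, x, hbx, hxl⟩ c ⟨hc, hcl, y, hcy, hyl⟩
    simp only [hN, hL, Finset.mem_filter, Set.mem_toFinset] at hl hb
    have hxy : x = y := (Set.ncard_le_one (Set.toFinite _)).1 hl.2.le x hxl.symm y hyl.symm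
    subst hxy
    by_contra hbc
    have hsub : ({b, c, l} : Set V) ⊆ H.neighborSet x := by
      rintro z (rfl | rfl | rfl)
      exacts [hbx.symm, hcy.symm, hxl]
    have h3 : ({b, c, l} : Set V).ncard = 3 :=
      Set.ncard_eq_three.2 ⟨b, c, l, hbc, hbl, hcl, rfl⟩
    have := Set.ncard_le_ncard hsub (Set.toFinite _)
    have := hdegA x (memA hb.1 hbx)
    omega
  have hsumL : ∑ b ∈ L, (H.neighborSet b).ncard = L.card := by
    rw [Finset.card_eq_sum_ones]
    exact Finset.sum_congr rfl fun b hb ↦ (Finset.mem_filter.1 hb).2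
  have hsumN : ∑ b ∈ N, (H.neighborSet b).ncard ≤ N.card * 3 :=
    Finset.sum_le_card_nsmul _ _ _ fun b hb ↦
      hdegB b (Set.mem_toFinset.1 (Finset.mem_filter.1 hb).1)
  have hsplit := Finset.sum_filter_add_sum_filter_not B.toFinset
    (fun b ↦ (H.neighborSet b).ncard = 1) (fun b ↦ (H.neighborSet b).ncard)
  have hcardB : L.card + N.card = B.toFinset.card := Finset.card_filter_add_card_filter_not _
  have hV : H.verts.ncard = A.toFinset.card + B.toFinset.card := by
    rw [← hcover, Set.ncard_union_eq hdisj, Set.ncard_eq_toFinset_card', Set.ncard_eq_toFinset_card']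
  rw [← hL, ← hN] at hsplit
  omega


/-- Let `G` be 3-regular and `H` a connected subgraph of `G` whose
vertex set is partitioned into independent sets `A` and `B`, where every vertex of `A`
has degree exactly `2` in `H` and every vertex of `B` is a leaf of `H` or at distance two
in `H` from some leaf of `H`.  Then `H` does not contain two distinct cycles, and
consequently `|E(H)| ≤ |V(H)|`. -/
theorem no_two_cycles_in_subdivision_corona_component {V : Type} [Fintype V] [DecidableEq V]
    (G : SimpleGraph V) (hreg : ∀ v : V, (G.neighborSet v).ncard = 3)
    (H : G.Subgraph) (hconn : H.Connected)
    (A B : Set V) (hdisj : Disjoint A B) (hcover : A ∪ B = H.verts)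
    (hAind : ∀ u ∈ A, ∀ v ∈ A, ¬ H.Adj u v)
    (hBind : ∀ u ∈ B, ∀ v ∈ B, ¬ H.Adj u v)
    (hdegA : ∀ a ∈ A, (H.neighborSet a).ncard = 2)
    (hB : ∀ b ∈ B, (H.neighborSet b).ncard = 1 ∨
      ∃ l : V, (H.neighborSet l).ncard = 1 ∧ b ≠ l ∧ ¬ H.Adj b l ∧
        ∃ x : V, H.Adj b x ∧ H.Adj x l) :
    (¬ ∃ (v w : H.verts) (p : H.coe.Walk v v) (q : H.coe.Walk w w),
        p.IsCycle ∧ q.IsCycle ∧ p.edges.toFinset ≠ q.edges.toFinset) ∧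
    H.edgeSet.ncard ≤ H.verts.ncard := by
  have hE : H.edgeSet.ncard ≤ H.verts.ncard := by
    refine H.ncard_edgeSet_le_ncard_verts hdisj hcover hAind hBind hdegA (fun b _ ↦ ?_)
      fun b hb ↦ (hB b hb).imp_right fun ⟨l, hl, hne, _, hx⟩ ↦ ⟨l, hl, hne, hx⟩
    exact hreg b ▸ Set.ncard_le_ncard (H.neighborSet_subset b) (Set.toFinite _)
  refine ⟨?_, hE⟩
  rintro ⟨v, w, p, q, hp, hq, hne⟩
  have hcard : Nat.card H.coe.edgeSet ≤ Nat.card H.verts := by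
    rwa [Nat.card_coe_set_eq, Nat.card_coe_set_eq,
      ← Set.ncard_image_of_injective _ (Sym2.map.injective Subtype.val_injective),
      H.image_coe_edgeSet_coe]
  refine hne (Finset.ext fun e ↦ ?_)
  simp only [List.mem_toFinset]
  exact ⟨hconn.coe.mem_edges_of_card_edgeSet_le hcard hp hq,
    hconn.coe.mem_edges_of_card_edgeSet_le hcard hq hp⟩
end

section
/- Let G=(V,E) be a finite simple graph, let w: V → ℕ assign a positive integer weight to each vertex, and let T ⊆ V. Construct G'=(V',E') with V' = V ∪ {t,p,q} (three new vertices) and E' = E ∪ {tp, tq} ∪ {tv : v ∈ V ∖ T}, with weights w'(v)=w(v) for v ∈ V, w'(t)=1, and w'(p)=w'(q)=|V|. Then: (i) for every T-dominating set D of G, the set D ∪ {t} is a dominating set of G' of weight w(D)+1; and (ii) the minimum weight of a dominating set of G' equals the minimum weight of a T-dominating set of G plus 1. -/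
/-- `D` is a `T`-dominating set of `G`: `D` meets the closed neighborhood of every
vertex of `T`. -/
def TDominating {V : Type*} (G : SimpleGraph V) (T D : Set V) : Prop :=
  ∀ v ∈ T, ∃ u ∈ D, u = v ∨ G.Adj u v

/-- The graph `G' = (V ∪ {t, p, q}, E ∪ {tp, tq} ∪ {tv : v ∉ T})`, where
`t = Sum.inr 0`, `p = Sum.inr 1`, `q = Sum.inr 2`. -/
def augGraph {V : Type*} (G : SimpleGraph V) (T : Set V) : SimpleGraph (V ⊕ Fin 3) :=
  SimpleGraph.fromRel (fun x y =>
    match x, y with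
    | Sum.inl u, Sum.inl v => G.Adj u v
    | Sum.inr i, Sum.inr j => i = 0 ∧ (j = 1 ∨ j = 2)
    | Sum.inr i, Sum.inl v => i = 0 ∧ v ∉ T
    | Sum.inl _, Sum.inr _ => False)

/-- The weight function `w'` on `V ∪ {t, p, q}`: `w'(v) = w(v)` for `v ∈ V`, `w'(t) = 1`
and `w'(p) = w'(q) = |V|`. -/
def augWeight {V : Type*} [Fintype V] (w : V → ℕ) : V ⊕ Fin 3 → ℕ :=
  Sum.elim w (fun i => if i = 0 then 1 else Fintype.card V)

section AugGraph

variable {V : Type*} {G : SimpleGraph V} {T : Set V}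

@[simp]
theorem augGraph_adj_inl_inl {u v : V} :
    (augGraph G T).Adj (Sum.inl u) (Sum.inl v) ↔ G.Adj u v := by
  simp only [augGraph, SimpleGraph.fromRel_adj, ne_eq, Sum.inl.injEq, G.adj_comm v u, or_self,
    and_iff_right_iff_imp]
  exact fun h => h.ne

@[simp]
theorem augGraph_adj_inr_inl {i : Fin 3} {v : V} :
    (augGraph G T).Adj (Sum.inr i) (Sum.inl v) ↔ i = 0 ∧ v ∉ T := by
  simp [augGraph]

@[simp]
theorem augGraph_adj_inl_inr {i : Fin 3} {v : V} :
    (augGraph G T).Adj (Sum.inl v) (Sum.inr i) ↔ i = 0 ∧ v ∉ T := by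
  simp [augGraph]

@[simp]
theorem augGraph_adj_inr_inr {i j : Fin 3} :
    (augGraph G T).Adj (Sum.inr i) (Sum.inr j) ↔ i = 0 ∧ j ≠ 0 ∨ i ≠ 0 ∧ j = 0 := by
  simp only [augGraph, SimpleGraph.fromRel_adj, ne_eq, Sum.inr.injEq]
  revert i j
  decide

theorem TDominating.dominating_augGraph [DecidableEq V] {D : Finset V}
    (hD : TDominating G T (↑D : Set V)) :
    Dominating (augGraph G T)
      (↑(D.image Sum.inl ∪ {Sum.inr (0 : Fin 3)}) : Set (V ⊕ Fin 3)) := by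
  rintro (v | i) hv
  · by_cases hvT : v ∈ T
    · obtain ⟨u, hu, rfl | huv⟩ := hD v hvT
      · simp_all
      · exact ⟨Sum.inl u, by simpa using hu, by simpa using huv⟩
    · exact ⟨Sum.inr 0, by simp, by simpa using hvT⟩
  · exact ⟨Sum.inr 0, by simp, by simpa using hv⟩

theorem Dominating.tDominating_toLeft {D : Finset (V ⊕ Fin 3)}
    (hD : Dominating (augGraph G T) (↑D : Set (V ⊕ Fin 3))) :
    TDominating G T (↑D.toLeft : Set V) := by
  intro v hv
  by_cases hvD : Sum.inl v ∈ D
  · exact ⟨v, by simpa using hvD, Or.inl rfl⟩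
  · obtain ⟨u | i, hu, huv⟩ := hD (Sum.inl v) (by simpa using hvD)
    · exact ⟨u, by simpa using hu, Or.inr (by simpa using huv)⟩
    · exact absurd hv (augGraph_adj_inr_inl.1 huv).2

/-- A dominating set of `augGraph G T` contains `t` or its pendant neighbour `p`. -/
theorem Dominating.toRight_nonempty {D : Finset (V ⊕ Fin 3)}
    (hD : Dominating (augGraph G T) (↑D : Set (V ⊕ Fin 3))) : D.toRight.Nonempty := by
  by_cases hp : Sum.inr 1 ∈ D
  · exact ⟨1, by simpa using hp⟩
  · obtain ⟨u | i, hu, huv⟩ := hD (Sum.inr 1) (by simpa using hp)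
    · simp at huv
    · exact ⟨i, by simpa using hu⟩

variable [Fintype V]

theorem sum_augWeight_image_union [DecidableEq V] (w : V → ℕ) (D : Finset V) :
    ∑ x ∈ D.image Sum.inl ∪ {Sum.inr (0 : Fin 3)}, augWeight w x = (∑ v ∈ D, w v) + 1 := by
  rw [Finset.sum_union (by simp), Finset.sum_image (by simp)]
  simp [augWeight]

theorem Dominating.sum_toLeft_add_one_le [Nonempty V] {D : Finset (V ⊕ Fin 3)}
    (hD : Dominating (augGraph G T) (↑D : Set (V ⊕ Fin 3))) (w : V → ℕ) :
    (∑ v ∈ D.toLeft, w v) + 1 ≤ ∑ x ∈ D, augWeight w x := by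
  have hpos : ∀ i : Fin 3, 0 < augWeight w (Sum.inr i) := by
    intro i
    simp only [augWeight, Sum.elim_inr]
    split_ifs
    · exact one_pos
    · exact Fintype.card_pos
  rw [← Finset.toLeft_disjSum_toRight (u := D), Finset.sum_disjSum, Finset.toLeft_disjSum]
  exact Nat.add_le_add_left (Finset.sum_pos (fun i _ => hpos i) hD.toRight_nonempty) _

end AugGraph

/-- (i) For every `T`-dominating set `D` of `G`, the set `D ∪ {t}` is a
dominating set of `G'` of weight `w(D) + 1`; (ii) the minimum weight of a dominating set
of `G'` equals the minimum weight of a `T`-dominating set of `G` plus `1`. -/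
theorem augGraph_dominating_correspondence {V : Type} [Fintype V] [DecidableEq V]
    [Nonempty V] (G : SimpleGraph V) (w : V → ℕ) (hw : ∀ v, 0 < w v) (T : Set V) :
    (∀ D : Finset V, TDominating G T (↑D : Set V) →
      Dominating (augGraph G T) (↑(D.image Sum.inl ∪ {Sum.inr (0 : Fin 3)}) : Set (V ⊕ Fin 3)) ∧
      ∑ x ∈ D.image Sum.inl ∪ {Sum.inr (0 : Fin 3)}, augWeight w x = (∑ v ∈ D, w v) + 1) ∧
    sInf {n : ℕ | ∃ D : Finset (V ⊕ Fin 3),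
        Dominating (augGraph G T) (↑D : Set (V ⊕ Fin 3)) ∧ ∑ x ∈ D, augWeight w x = n}
      = sInf {n : ℕ | ∃ D : Finset V,
          TDominating G T (↑D : Set V) ∧ ∑ v ∈ D, w v = n} + 1 := by
  refine ⟨fun D hD => ⟨hD.dominating_augGraph, sum_augWeight_image_union w D⟩,
    le_antisymm ?_ ?_⟩
  · have hne : {n : ℕ | ∃ D : Finset V,
        TDominating G T (↑D : Set V) ∧ ∑ v ∈ D, w v = n}.Nonempty :=
      ⟨_, Finset.univ, fun v _ => ⟨v, by simp, Or.inl rfl⟩, rfl⟩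
    obtain ⟨D, hD, hDw⟩ := Nat.sInf_mem hne
    rw [← hDw]
    exact Nat.sInf_le ⟨_, hD.dominating_augGraph, sum_augWeight_image_union w D⟩
  · have hne : {n : ℕ | ∃ D : Finset (V ⊕ Fin 3),
        Dominating (augGraph G T) (↑D : Set (V ⊕ Fin 3)) ∧
          ∑ x ∈ D, augWeight w x = n}.Nonempty :=
      ⟨_, Finset.univ, fun v hv => absurd (by simp) hv, rfl⟩
    obtain ⟨D, hD, hDw⟩ := Nat.sInf_mem hne
    rw [← hDw]
    refine le_trans (Nat.add_le_add_right (Nat.sInf_le ?_) 1) (hD.sum_toLeft_add_one_le w)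
    exact ⟨D.toLeft, hD.tDominating_toLeft, rfl⟩
end

section
/- Let G be a finite simple graph with at least one vertex, and let G' be the graph obtained from G by adding, for each vertex v of G, exactly one new pendant vertex adjacent to v (the corona G ∘ K₁). Then G' is not a DD₂-graph. In contrast, if G'' is obtained from G by adding, for each vertex v of G, at least two new pendant vertices adjacent to v, then G'' is a DD₂-graph. -/
/-- The corona `G ∘ K₁`: to each vertex `v` of `G` one new pendant vertex `Sum.inr v`
is attached. -/
def coronaOne {V : Type*} (G : SimpleGraph V) : SimpleGraph (V ⊕ V) :=
  SimpleGraph.fromRel (fun x y =>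
    match x, y with
    | Sum.inl u, Sum.inl v => G.Adj u v
    | Sum.inl u, Sum.inr v => u = v
    | _, _ => False)

/-- The graph obtained from `G` by attaching `k v` new pendant vertices to each vertex
`v` of `G`. -/
def coronaMany {V : Type*} (G : SimpleGraph V) (k : V → ℕ) :
    SimpleGraph (V ⊕ (Σ v : V, Fin (k v))) :=
  SimpleGraph.fromRel (fun x y =>
    match x, y with
    | Sum.inl u, Sum.inl v => G.Adj u v
    | Sum.inl u, Sum.inr p => u = p.1
    | _, _ => False)

theorem coronaOne_adj_inr_iff {V : Type*} (G : SimpleGraph V) (x : V ⊕ V) (v : V) :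
    (coronaOne G).Adj x (Sum.inr v) ↔ x = Sum.inl v := by
  cases x <;> simp [coronaOne]

theorem coronaOne_adj_inr_inl_iff {V : Type*} (G : SimpleGraph V) (u v : V) :
    (coronaOne G).Adj (Sum.inr u) (Sum.inl v) ↔ u = v := by
  rw [SimpleGraph.adj_comm, coronaOne_adj_inr_iff, Sum.inl.injEq, eq_comm]

theorem coronaMany_adj_inl_inr_iff {V : Type*} (G : SimpleGraph V) (k : V → ℕ) (v : V)
    (p : Σ v : V, Fin (k v)) :
    (coronaMany G k).Adj (Sum.inl v) (Sum.inr p) ↔ v = p.1 := by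
  simp [coronaMany]

/-- In a corona `G ∘ K₁`, every pendant vertex lies in every 2-dominating set. -/
theorem TwoDominating.inr_mem_coronaOne {V : Type*} {G : SimpleGraph V} {D : Set (V ⊕ V)}
    (hD : TwoDominating (coronaOne G) D) (v : V) : Sum.inr v ∈ D := by
  by_contra hv
  obtain ⟨u, -, w, -, huw, hu, hw⟩ := hD _ hv
  rw [coronaOne_adj_inr_iff] at hu hw
  exact huw (hu.trans hw.symm)

theorem not_isDD2_coronaOne {V : Type*} [Nonempty V] (G : SimpleGraph V) :
    ¬ IsDD2 (coronaOne G) := by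
  rintro ⟨D, D2, hdisj, hD, hD2⟩
  have inl_mem (v : V) : Sum.inl v ∈ D := by
    obtain ⟨u, hu, huv⟩ := hD _ (hdisj.notMem_of_mem_right (hD2.inr_mem_coronaOne v))
    rw [coronaOne_adj_inr_iff] at huv
    exact huv ▸ hu
  have eq_inr (v : V) (x : V ⊕ V) (hx : x ∈ D2) (hxv : (coronaOne G).Adj x (Sum.inl v)) :
      x = Sum.inr v := by
    cases x with
    | inl u => exact absurd hx (hdisj.notMem_of_mem_left (inl_mem u))
    | inr u => rw [(coronaOne_adj_inr_inl_iff G u v).1 hxv]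
  obtain ⟨v⟩ := ‹Nonempty V›
  obtain ⟨u, hu, w, hw, huw, huv, hwv⟩ := hD2 _ (hdisj.notMem_of_mem_left (inl_mem v))
  exact huw ((eq_inr v u hu huv).trans (eq_inr v w hw hwv).symm)

theorem isDD2_coronaMany {V : Type*} (G : SimpleGraph V) (k : V → ℕ) (hk : ∀ v, 2 ≤ k v) :
    IsDD2 (coronaMany G k) := by
  refine ⟨Set.range Sum.inl, Set.range Sum.inr, Set.isCompl_range_inl_range_inr.disjoint, ?_, ?_⟩
  · rintro (v | p) hv
    · exact absurd ⟨v, rfl⟩ hv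
    · exact ⟨Sum.inl p.1, ⟨p.1, rfl⟩, (coronaMany_adj_inl_inr_iff G k _ _).2 rfl⟩
  · rintro (v | p) hv
    · have hkv := hk v
      refine ⟨Sum.inr ⟨v, ⟨0, by omega⟩⟩, ⟨_, rfl⟩, Sum.inr ⟨v, ⟨1, by omega⟩⟩, ⟨_, rfl⟩,
        by simp, ?_, ?_⟩ <;>
      exact ((coronaMany_adj_inl_inr_iff G k _ _).2 rfl).symm
    · exact absurd ⟨p, rfl⟩ hv

/-- Attaching exactly one pendant vertex to every vertex of a (nonempty)
graph `G` yields a non-`DD₂`-graph, while attaching at least two pendant vertices to every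
vertex of `G` yields a `DD₂`-graph. -/
theorem coronaOne_not_isDD2_and_coronaMany_isDD2 {V : Type} [Fintype V] [Nonempty V]
    (G : SimpleGraph V) (k : V → ℕ) (hk : ∀ v, 2 ≤ k v) :
    ¬ IsDD2 (coronaOne G) ∧ IsDD2 (coronaMany G k) := by
  exact ⟨not_isDD2_coronaOne G, isDD2_coronaMany G k hk⟩
end

section
/- For every n ≥ 1, the path P_n on n vertices is a DD₂-graph if and only if n = 3 or n ≥ 5. -/
/-- In a path, both ends of the vertex order lie in every 2-dominating set. -/
theorem TwoDominating.mem_of_endpoint {n : ℕ} {D : Set (Fin n)}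
    (h : TwoDominating (SimpleGraph.pathGraph n) D) {v : Fin n}
    (hv : v.val = 0 ∨ v.val + 1 = n) : v ∈ D := by
  by_contra hD
  obtain ⟨u, -, w, -, hne, hu, hw⟩ := h v hD
  rw [SimpleGraph.pathGraph_adj] at hu hw
  exact hne (Fin.ext (by omega))

/-- Paths with an odd number `n ≥ 3` of vertices are `DD₂`-graphs: split by parity. -/
theorem isDD2_pathGraph_of_odd {n : ℕ} (hn : 3 ≤ n) (hodd : n % 2 = 1) :
    IsDD2 (SimpleGraph.pathGraph n) := by
  refine ⟨{v | v.val % 2 = 1}, {v | v.val % 2 = 0}, ?_, fun v hv ↦ ?_, fun v hv ↦ ?_⟩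
  · rw [Set.disjoint_left]
    intro v hv hv'
    simp only [Set.mem_ofPred_eq] at hv hv'
    omega
  · simp only [Set.mem_ofPred_eq] at hv
    by_cases h0 : v.val = 0
    · refine ⟨⟨1, by omega⟩, by simp, ?_⟩
      simp [SimpleGraph.pathGraph_adj, h0]
    · refine ⟨⟨v.val - 1, by omega⟩, ?_, ?_⟩
      · simp only [Set.mem_ofPred_eq]
        omega
      · simp only [SimpleGraph.pathGraph_adj]
        omega
  · simp only [Set.mem_ofPred_eq] at hv
    refine ⟨⟨v.val - 1, by omega⟩, ?_, ⟨v.val + 1, by omega⟩, ?_, ?_, ?_, ?_⟩ <;>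
      simp only [Set.mem_ofPred_eq, SimpleGraph.pathGraph_adj, ne_eq, Fin.mk.injEq,
        or_true] <;> omega

/-- Paths with an even number `n ≥ 6` of vertices are `DD₂`-graphs: take `D` to be
`{1, 4, 6, …, n - 2}` and `D₂` its complement. -/
theorem isDD2_pathGraph_of_even {n : ℕ} (hn : 6 ≤ n) (heven : n % 2 = 0) :
    IsDD2 (SimpleGraph.pathGraph n) := by
  let D : Set (Fin n) := {v | v.val = 1 ∨ 4 ≤ v.val ∧ v.val % 2 = 0}
  refine ⟨D, Dᶜ, disjoint_compl_right, fun v hv ↦ ?_, fun v hv ↦ ?_⟩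
  · simp only [D, Set.mem_ofPred_eq] at hv
    have key : ∃ k : ℕ, k < n ∧ (k = 1 ∨ 4 ≤ k ∧ k % 2 = 0) ∧ (k + 1 = v.val ∨ v.val + 1 = k) := by
      by_cases h0 : v.val ≤ 2
      · exact ⟨1, by omega⟩
      · by_cases h3 : v.val = 3
        · exact ⟨4, by omega⟩
        · exact ⟨v.val - 1, by omega⟩
    obtain ⟨k, hk, hkD, hadj⟩ := key
    exact ⟨⟨k, hk⟩, hkD, SimpleGraph.pathGraph_adj.2 hadj⟩
  · simp only [D, Set.mem_compl_iff, Set.mem_ofPred_eq, not_not] at hv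
    refine ⟨⟨v.val - 1, by omega⟩, ?_, ⟨v.val + 1, by omega⟩, ?_, ?_, ?_, ?_⟩ <;>
      simp only [D, Set.mem_compl_iff, Set.mem_ofPred_eq, SimpleGraph.pathGraph_adj, ne_eq,
        Fin.mk.injEq, or_true] <;> omega

/-- The path on four vertices is not a `DD₂`-graph. -/
theorem not_isDD2_pathGraph_four : ¬ IsDD2 (SimpleGraph.pathGraph 4) := by
  rintro ⟨D, D2, hdisj, hD, hD2⟩
  rw [Set.disjoint_left] at hdisj
  have h1 : (1 : Fin 4) ∈ D := by
    obtain ⟨u, hu, hadj⟩ := hD 0 fun h ↦ hdisj h (hD2.mem_of_endpoint (by simp))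
    rw [SimpleGraph.pathGraph_adj] at hadj
    fin_cases u <;> simp_all
  have h2 : (2 : Fin 4) ∈ D := by
    obtain ⟨u, hu, hadj⟩ := hD 3 fun h ↦ hdisj h (hD2.mem_of_endpoint (by simp))
    rw [SimpleGraph.pathGraph_adj] at hadj
    fin_cases u <;> simp_all
  obtain ⟨u, hu, w, hw, hne, hadj, hadj'⟩ := hD2 1 (hdisj h1)
  have hu2 : u ≠ 2 := fun h ↦ hdisj h2 (h ▸ hu)
  have hw2 : w ≠ 2 := fun h ↦ hdisj h2 (h ▸ hw)
  rw [SimpleGraph.pathGraph_adj] at hadj hadj'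
  fin_cases u <;> fin_cases w <;> simp_all

/-- For `n ≥ 1`, the path `P_n` on `n` vertices is a `DD₂`-graph if and
only if `n = 3` or `n ≥ 5`. -/
theorem pathGraph_isDD2_iff (n : ℕ) (hn : 1 ≤ n) :
    IsDD2 (SimpleGraph.pathGraph n) ↔ n = 3 ∨ 5 ≤ n := by
  constructor
  · intro h
    by_contra hcon
    obtain rfl | hn2 : n = 4 ∨ n ≤ 2 := by omega
    · exact not_isDD2_pathGraph_four h
    · obtain ⟨D, D2, hdisj, hD, hD2⟩ := h
      have hmem (v : Fin n) : v ∉ D := fun h ↦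
        Set.disjoint_left.1 hdisj h (hD2.mem_of_endpoint (by omega))
      obtain ⟨u, hu, -⟩ := hD ⟨0, hn⟩ (hmem _)
      exact hmem u hu
  · intro h
    rcases Nat.mod_two_eq_zero_or_one n with heven | hodd
    · exact isDD2_pathGraph_of_even (by omega) heven
    · exact isDD2_pathGraph_of_odd (by omega) hodd
end
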